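/- Real-part sign conditions for the g-function: Re(2g(z) + 1) > 0 for z in a deleted neighborhood of I_i (minus I_i itself), and Re(2g(z) - 1) < 0 for z in a deleted neighborhood of I_e (minus I_e itself). -/

import Mathlib

open Complex Set Filter

namespace GSigns

/-- a branch of the square root, analytic across the real axis minus the origin -/
noncomputable def sq (w : ℂ) : ℂ := exp (((Real.pi / 2 : ℝ) * I + log (-I * w)) / 2)

/-- the product of square roots -/
noncomputable def S (a : ℕ → ℝ) (n : ℕ) (z : ℂ) : ℂ := ∏ j ∈ Finset.range n, sq (z - (a j : ℂ))

lemma sq_ne (w : ℂ) : sq w ≠ 0 := exp_ne_zero _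

lemma sq_sq {w : ℂ} (hw : w ≠ 0) : sq w ^ 2 = w := by
  unfold sq
  rw [← Complex.exp_nat_mul]
  have : ((2 : ℕ) : ℂ) * ((((Real.pi / 2 : ℝ) : ℂ) * I + log (-I * w)) / 2)
      = (Real.pi / 2 : ℂ) * I + log (-I * w) := by push_cast; ring
  rw [this, Complex.exp_add, Complex.exp_log (by simp [hw]), Complex.exp_pi_div_two_mul_I]
  rw [← mul_assoc]; simp

lemma norm_sq {w : ℂ} (hw : w ≠ 0) : ‖sq w‖ = √‖w‖ := by
  have := congrArg norm (sq_sq hw)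
  rw [norm_pow] at this
  rw [← this, Real.sqrt_sq (norm_nonneg _)]

lemma sq_diff {w : ℂ} (hw : w ≠ 0) (him : 0 ≤ w.im) : DifferentiableAt ℂ sq w := by
  unfold sq
  have : -I * w ∈ slitPlane := by
    rw [mem_slitPlane_iff]
    by_contra h
    push Not at h
    obtain ⟨h1, h2⟩ := h
    simp at h1 h2
    exact hw (Complex.ext h2 (by simp; linarith))
  have h2 : DifferentiableAt ℂ (fun w : ℂ => -I * w) w := by fun_prop
  have h3 := h2.clog this
  fun_prop

lemma sqrt_exp {x : ℝ} (hx : 0 < x) : √x = Real.exp (Real.log x / 2) := by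
  rw [Real.sqrt_eq_rpow, Real.rpow_def_of_pos hx]; congr 1; ring

lemma sq_pos {x : ℝ} (hx : 0 < x) : sq x = (√x : ℝ) := by
  unfold sq
  have : -I * (x : ℂ) = (x : ℂ) * (-I) := by ring
  rw [this, Complex.log_ofReal_mul hx (by simp), log_neg_I, sqrt_exp hx]
  push_cast
  congr 1
  ring

lemma sq_neg {x : ℝ} (hx : x < 0) : sq x = I * (√(-x) : ℝ) := by
  unfold sq
  have : -I * (x : ℂ) = ((-x : ℝ) : ℂ) * I := by push_cast; ring
  have h0 : 0 < -x := by linarith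
  rw [this, Complex.log_ofReal_mul h0 (by simp), log_I, sqrt_exp h0]
  push_cast
  conv_rhs => rw [← Complex.exp_pi_div_two_mul_I, ← Complex.exp_add]
  congr 1
  ring

lemma S_ne (a : ℕ → ℝ) (n : ℕ) (z : ℂ) : S a n z ≠ 0 :=
  Finset.prod_ne_zero_iff.2 fun _ _ => sq_ne _

lemma S_sq {a : ℕ → ℝ} {n : ℕ} {z : ℂ} (hz : ∀ j < n, z ≠ a j) :
    S a n z ^ 2 = ∏ j ∈ Finset.range n, (z - (a j : ℂ)) := by
  unfold S
  rw [← Finset.prod_pow]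
  refine Finset.prod_congr rfl fun j hj => sq_sq ?_
  exact sub_ne_zero.2 (hz j (Finset.mem_range.1 hj))

lemma S_diff {a : ℕ → ℝ} {n : ℕ} {z : ℂ} (hz : ∀ j < n, z ≠ a j) (him : 0 ≤ z.im) :
    DifferentiableAt ℂ (S a n) z := by
  unfold S
  refine DifferentiableAt.fun_finsetProd fun j hj => ?_
  have h := sq_diff (w := z - a j) (sub_ne_zero.2 (hz j (Finset.mem_range.1 hj))) (by simpa using him)
  exact DifferentiableAt.comp (g := sq) (f := fun z : ℂ => z - (a j : ℂ)) z h (by fun_prop)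

lemma S_real {a : ℕ → ℝ} {n m : ℕ} (hm : m ≤ n) {x : ℝ} (h1 : ∀ j < m, a j < x)
    (h2 : ∀ j, m ≤ j → j < n → x < a j) : ∃ ρ : ℝ, 0 < ρ ∧ S a n x = I ^ (n - m) * ρ := by
  refine ⟨(∏ j ∈ Finset.range m, √(x - a j)) * ∏ j ∈ Finset.Ico m n, √(-(x - a j)), ?_, ?_⟩
  · apply mul_pos
    · exact Finset.prod_pos fun j hj => Real.sqrt_pos.2 (by linarith [h1 j (Finset.mem_range.1 hj)])
    · refine Finset.prod_pos fun j hj => Real.sqrt_pos.2 ?_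
      have := Finset.mem_Ico.1 hj
      linarith [h2 j this.1 this.2]
  · unfold S
    rw [← Finset.prod_range_mul_prod_Ico _ hm]
    have e1 : ∏ j ∈ Finset.range m, sq ((x : ℂ) - a j) = ∏ j ∈ Finset.range m, ((√(x - a j) : ℝ) : ℂ) := by
      refine Finset.prod_congr rfl fun j hj => ?_
      rw [← ofReal_sub, sq_pos (by linarith [h1 j (Finset.mem_range.1 hj)])]
    have e2 : ∏ j ∈ Finset.Ico m n, sq ((x : ℂ) - a j)
        = ∏ j ∈ Finset.Ico m n, (I * ((√(-(x - a j)) : ℝ) : ℂ)) := by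
      refine Finset.prod_congr rfl fun j hj => ?_
      have := Finset.mem_Ico.1 hj
      rw [← ofReal_sub, sq_neg (by linarith [h2 j this.1 this.2])]
    rw [e1, e2, Finset.prod_mul_distrib, Finset.prod_const, Nat.card_Ico]
    push_cast
    ring

lemma prod_sign {b : ℕ → ℝ} {n m : ℕ} (hm : m ≤ n) {x : ℝ} (h1 : ∀ j < m, b j < x)
    (h2 : ∀ j, m ≤ j → j < n → x < b j) :
    ∃ ρ : ℝ, 0 < ρ ∧ ∏ j ∈ Finset.range n, (x - b j) = (-1) ^ (n - m) * ρ := by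
  refine ⟨(∏ j ∈ Finset.range m, (x - b j)) * ∏ j ∈ Finset.Ico m n, (-(x - b j)), ?_, ?_⟩
  · apply mul_pos
    · exact Finset.prod_pos fun j hj => by linarith [h1 j (Finset.mem_range.1 hj)]
    · refine Finset.prod_pos fun j hj => ?_
      have := Finset.mem_Ico.1 hj
      linarith [h2 j this.1 this.2]
  · rw [← Finset.prod_range_mul_prod_Ico _ hm]
    have e2 : ∏ j ∈ Finset.Ico m n, (x - b j)
        = ∏ j ∈ Finset.Ico m n, ((-1) * (-(x - b j))) := by
      refine Finset.prod_congr rfl fun j hj => ?_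
      ring
    rw [e2, Finset.prod_mul_distrib, Finset.prod_const, Nat.card_Ico]
    ring

/-- the differential on the closed upper half plane -/
noncomputable def W (a : ℕ → ℝ) (n : ℕ) (p : Polynomial ℂ) (z : ℂ) : ℂ := p.eval z / S a n z

lemma W_diff {a : ℕ → ℝ} {n : ℕ} (p : Polynomial ℂ) {z : ℂ} (hz : ∀ j < n, z ≠ a j)
    (him : 0 ≤ z.im) : DifferentiableAt ℂ (W a n p) z := by
  unfold W
  exact (p.differentiable z).div (S_diff hz him) (S_ne _ _ _)

lemma ne_of_im_pos {z : ℂ} (hz : 0 < z.im) (x : ℝ) : z ≠ x := by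
  rintro rfl; simp at hz

lemma integrable_inv_sqrt (c u v : ℝ) :
    IntervalIntegrable (fun x : ℝ => (√|x - c|)⁻¹) MeasureTheory.volume u v := by
  have h := (intervalIntegral.intervalIntegrable_cpow' (a := u - c) (b := v - c)
    (r := ((-1/2 : ℝ) : ℂ)) (by rw [ofReal_re]; norm_num)).norm
  have h2 := h.comp_sub_right c
  simp only [sub_add_cancel] at h2
  refine h2.congr ?_
  intro x _
  simp only
  rcases eq_or_ne (x - c) 0 with h0 | h0
  · rw [h0]; simp
  · rw [Complex.norm_cpow_real, Complex.norm_real, Real.norm_eq_abs, Real.sqrt_eq_rpow,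
      ← Real.rpow_neg (abs_nonneg _)]
    norm_num

lemma prod_bound {a : ℕ → ℝ} {n : ℕ} (hmono : ∀ i j, i < j → j < n → a i < a j) :
    ∃ C : ℝ, ∀ x : ℝ, ∏ j ∈ Finset.range n, (√|x - a j|)⁻¹
      ≤ C * (1 + ∑ j ∈ Finset.range n, (√|x - a j|)⁻¹) := by
  -- minimal separation
  obtain ⟨m, hm0, hm⟩ : ∃ m : ℝ, 0 < m ∧ ∀ i < n, ∀ j < n, i ≠ j → m ≤ |a i - a j| := by
    let T : Finset ℝ := insert 1 (((Finset.range n ×ˢ Finset.range n).filter fun q => q.1 ≠ q.2).image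
      fun q => |a q.1 - a q.2|)
    have hT : T.Nonempty := ⟨1, by simp [T]⟩
    refine ⟨T.min' hT, ?_, ?_⟩
    · rw [Finset.lt_min'_iff]
      intro y hy
      simp only [T, Finset.mem_insert, Finset.mem_image, Finset.mem_filter, Finset.mem_product,
        Finset.mem_range] at hy
      rcases hy with rfl | ⟨⟨i, j⟩, ⟨⟨hi, hj⟩, hij⟩, rfl⟩
      · norm_num
      · apply abs_pos.2
        rcases lt_or_gt_of_ne hij with h | h
        · have := hmono _ _ h hj
          exact sub_ne_zero.2 (ne_of_lt this)
        · have := hmono _ _ h hi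
          exact sub_ne_zero.2 (ne_of_gt this)
    · intro i hi j hj hij
      apply Finset.min'_le
      simp only [T, Finset.mem_insert, Finset.mem_image, Finset.mem_filter, Finset.mem_product,
        Finset.mem_range]
      exact Or.inr ⟨(i, j), ⟨⟨hi, hj⟩, hij⟩, rfl⟩
  set K : ℝ := max 1 (√(m/2))⁻¹ with hK
  have hK1 : 1 ≤ K := le_max_left _ _
  refine ⟨K ^ n, fun x => ?_⟩
  have hfar : ∀ j, m / 2 ≤ |x - a j| → (√|x - a j|)⁻¹ ≤ K := by
    intro j hj
    refine le_trans ?_ (le_max_right _ _)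
    exact inv_anti₀ (Real.sqrt_pos.2 (by linarith)) (Real.sqrt_le_sqrt hj)
  have hnn : ∀ j, 0 ≤ (√|x - a j|)⁻¹ := fun j => by positivity
  have hsum : 0 ≤ ∑ j ∈ Finset.range n, (√|x - a j|)⁻¹ := Finset.sum_nonneg fun j _ => hnn j
  by_cases hex : ∃ j < n, |x - a j| < m / 2
  · obtain ⟨j, hj, hjx⟩ := hex
    have hjm : j ∈ Finset.range n := Finset.mem_range.2 hj
    rw [← Finset.mul_prod_erase _ _ hjm]
    have hp : ∏ i ∈ (Finset.range n).erase j, (√|x - a i|)⁻¹ ≤ K ^ n := by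
      calc _ ≤ ∏ i ∈ (Finset.range n).erase j, K := by
            refine Finset.prod_le_prod (fun i _ => hnn i) fun i hi => hfar i ?_
            rw [Finset.mem_erase, Finset.mem_range] at hi
            have h1 := hm i hi.2 j hj hi.1
            have h2 : |a i - a j| ≤ |x - a i| + |x - a j| := by
              have : a i - a j = (x - a j) - (x - a i) := by ring
              rw [this]
              exact (abs_sub _ _).trans (by linarith)
            linarith
        _ = K ^ (n - 1) := by
            rw [Finset.prod_const, Finset.card_erase_of_mem hjm, Finset.card_range]
        _ ≤ K ^ n := pow_le_pow_right₀ hK1 (by omega)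
    have hs : (√|x - a j|)⁻¹ ≤ 1 + ∑ j ∈ Finset.range n, (√|x - a j|)⁻¹ := by
      have := Finset.single_le_sum (f := fun j => (√|x - a j|)⁻¹) (fun i _ => hnn i) hjm
      linarith
    have : 0 ≤ K ^ n := by positivity
    rw [mul_comm]
    exact mul_le_mul hp hs (hnn j) this
  · push Not at hex
    calc _ ≤ ∏ i ∈ Finset.range n, K :=
          Finset.prod_le_prod (fun i _ => hnn i) fun i hi => hfar i (hex i (Finset.mem_range.1 hi))
      _ = K ^ n * 1 := by simp
      _ ≤ _ := by
        have : 0 ≤ K ^ n := by positivity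
        exact mul_le_mul_of_nonneg_left (by linarith) this

lemma bound_integrable (a : ℕ → ℝ) (n : ℕ) (M C u v : ℝ) :
    IntervalIntegrable (fun x : ℝ => M * (C * (1 + ∑ j ∈ Finset.range n, (√|x - a j|)⁻¹)))
      MeasureTheory.volume u v := by
  refine IntervalIntegrable.const_mul (IntervalIntegrable.const_mul (IntervalIntegrable.add ?_ ?_) _) _
  · exact intervalIntegrable_const
  · have := IntervalIntegrable.sum (μ := MeasureTheory.volume) (a := u) (b := v) (Finset.range n)
      (f := fun j => fun x : ℝ => (√|x - a j|)⁻¹) (fun j _ => integrable_inv_sqrt (a j) u v)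
    have e : (fun x : ℝ => ∑ j ∈ Finset.range n, (√|x - a j|)⁻¹)
        = ∑ j ∈ Finset.range n, fun x : ℝ => (√|x - a j|)⁻¹ := by
      ext x; simp
    rw [e]; exact this

lemma norm_W_le {a : ℕ → ℝ} {n : ℕ} (p : Polynomial ℂ) {x y M : ℝ} (hx : ∀ j < n, x ≠ a j)
    (hM : ‖p.eval (x + y * I : ℂ)‖ ≤ M) :
    ‖W a n p (x + y * I : ℂ)‖ ≤ M * ∏ j ∈ Finset.range n, (√|x - a j|)⁻¹ := by
  unfold W S
  rw [norm_div, norm_prod, div_eq_mul_inv, ← Finset.prod_inv_distrib]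
  have h0 : 0 ≤ M := (norm_nonneg _).trans hM
  refine mul_le_mul hM ?_ (Finset.prod_nonneg fun _ _ => by positivity) h0
  refine Finset.prod_le_prod (fun _ _ => by positivity) fun j hj => ?_
  have hxj := hx j (Finset.mem_range.1 hj)
  have hre : ((x + y * I : ℂ) - a j).re = x - a j := by simp
  have hne : (x + y * I : ℂ) - a j ≠ 0 := by
    intro h; rw [h] at hre; simp at hre; exact hxj (by linarith)
  rw [norm_sq hne]
  refine inv_anti₀ (Real.sqrt_pos.2 (abs_pos.2 (sub_ne_zero.2 hxj))) (Real.sqrt_le_sqrt ?_)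
  rw [← hre]; exact Complex.abs_re_le_norm _

lemma W_integrable {a : ℕ → ℝ} {n : ℕ} (hmono : ∀ i j, i < j → j < n → a i < a j)
    (p : Polynomial ℂ) (u v : ℝ) :
    IntervalIntegrable (fun x : ℝ => W a n p x) MeasureTheory.volume u v := by
  obtain ⟨C, hC⟩ := prod_bound hmono
  obtain ⟨M, hM⟩ := (isCompact_uIcc (a := u) (b := v)).exists_bound_of_continuousOn
    (f := fun x : ℝ => p.eval (x : ℂ)) (by fun_prop)
  have hfin : {x : ℝ | ∃ j < n, x = a j}.Finite := by
    refine ((Finset.range n).image a).finite_toSet.subset ?_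
    rintro x ⟨j, hj, rfl⟩
    simp only [Finset.coe_image, mem_image]
    exact ⟨j, by simpa using hj, rfl⟩
  have hae : ∀ᵐ x : ℝ, ∀ j < n, x ≠ a j := by
    have := hfin.countable.ae_notMem MeasureTheory.volume
    filter_upwards [this] with x hx j hj h
    exact hx ⟨j, hj, h⟩
  refine (bound_integrable a n M C u v).mono_fun ?_ ?_
  · apply MeasureTheory.AEStronglyMeasurable.restrict
    have hm : ContinuousOn (fun x : ℝ => W a n p x) {x : ℝ | ∃ j < n, x = a j}ᶜ := by
      intro x hx
      apply ContinuousAt.continuousWithinAt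
      have : ∀ j < n, (x : ℂ) ≠ a j := by
        intro j hj h
        exact hx ⟨j, hj, by exact_mod_cast h⟩
      exact ContinuousAt.comp (f := fun x : ℝ => (x : ℂ)) (g := W a n p)
        (W_diff p this (by simp)).continuousAt (by fun_prop)
    have h1 := hm.aestronglyMeasurable (μ := MeasureTheory.volume) hfin.measurableSet.compl
    have h2 : MeasureTheory.volume.restrict {x : ℝ | ∃ j < n, x = a j}ᶜ = MeasureTheory.volume := by
      apply MeasureTheory.Measure.restrict_eq_self_of_ae_mem
      filter_upwards [hae] with x hx
      rintro ⟨j, hj, h⟩; exact hx j hj h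
    rwa [h2] at h1
  · have := (MeasureTheory.ae_restrict_of_ae (s := uIoc u v) hae)
    filter_upwards [this, MeasureTheory.ae_restrict_mem measurableSet_uIoc] with x hx hx2
    have h := norm_W_le (y := 0) p hx (M := M) (by simpa using hM x (uIoc_subset_uIcc hx2))
    simp only [ofReal_zero, zero_mul, add_zero] at h
    have hM0 : 0 ≤ M := (norm_nonneg _).trans (hM x (uIoc_subset_uIcc hx2))
    refine h.trans ((mul_le_mul_of_nonneg_left (hC x) hM0).trans ?_)
    exact le_abs_self _

lemma ae_ne (a : ℕ → ℝ) (n : ℕ) : ∀ᵐ x : ℝ, ∀ j < n, x ≠ a j := by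
  have hfin : {x : ℝ | ∃ j < n, x = a j}.Finite := by
    refine ((Finset.range n).image a).finite_toSet.subset ?_
    rintro x ⟨j, hj, rfl⟩
    simp only [Finset.coe_image, mem_image]
    exact ⟨j, by simpa using hj, rfl⟩
  have := hfin.countable.ae_notMem MeasureTheory.volume
  filter_upwards [this] with x hx j hj h
  exact hx ⟨j, hj, h⟩

/-- horizontal integrals converge to the boundary integral -/
lemma tendsto_horizontal {a : ℕ → ℝ} {n : ℕ} (hmono : ∀ i j, i < j → j < n → a i < a j)
    (p : Polynomial ℂ) (u v : ℝ) :
    Tendsto (fun ε : ℝ => ∫ x in u..v, W a n p (x + ε * I : ℂ)) (nhdsWithin 0 (Ioi 0))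
      (nhds (∫ x in u..v, W a n p x)) := by
  obtain ⟨C, hC⟩ := prod_bound hmono
  obtain ⟨M, hM⟩ := ((isCompact_uIcc (a := u) (b := v)).prod (isCompact_Icc (a := (0:ℝ)) (b := 1))).exists_bound_of_continuousOn
    (f := fun q : ℝ × ℝ => p.eval (q.1 + q.2 * I : ℂ)) (by fun_prop)
  have hev : ∀ᶠ ε : ℝ in nhdsWithin 0 (Ioi 0), ε ∈ Ioo (0:ℝ) 1 :=
    Ioo_mem_nhdsGT (by norm_num)
  refine intervalIntegral.tendsto_integral_filter_of_dominated_convergence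
    (fun x : ℝ => M * (C * (1 + ∑ j ∈ Finset.range n, (√|x - a j|)⁻¹))) ?_ ?_
    (bound_integrable a n M C u v) ?_
  · filter_upwards [hev] with ε hε
    apply Continuous.aestronglyMeasurable
    rw [continuous_iff_continuousAt]
    intro x
    have him : 0 < (x + ε * I : ℂ).im := by simpa using hε.1
    exact ContinuousAt.comp (f := fun x : ℝ => (x + ε * I : ℂ)) (g := W a n p)
        (W_diff p (fun j _ => ne_of_im_pos him _) him.le).continuousAt (by fun_prop)
  · filter_upwards [hev] with ε hε
    filter_upwards [ae_ne a n] with x hx hx2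
    have hb := hM (x, ε) ⟨uIoc_subset_uIcc hx2, hε.1.le, hε.2.le⟩
    have h := norm_W_le (y := ε) p hx hb
    have hM0 : 0 ≤ M := (norm_nonneg _).trans hb
    exact h.trans (mul_le_mul_of_nonneg_left (hC x) hM0)
  · filter_upwards [ae_ne a n] with x hx _
    have h1 : ContinuousAt (W a n p) (x : ℂ) :=
      (W_diff p (fun j hj h => hx j hj (by exact_mod_cast h)) (by simp)).continuousAt
    have h2 : Tendsto (fun ε : ℝ => (x + ε * I : ℂ)) (nhdsWithin 0 (Ioi 0)) (nhds (x : ℂ)) := by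
      have : Continuous (fun ε : ℝ => (x + ε * I : ℂ)) := by fun_prop
      have h3 := this.tendsto 0
      simp only [ofReal_zero, zero_mul, add_zero] at h3
      exact h3.mono_left nhdsWithin_le_nhds
    exact h1.tendsto.comp h2

lemma boundary {a : ℕ → ℝ} {n : ℕ} (hmono : ∀ i j, i < j → j < n → a i < a j)
    (p : Polynomial ℂ) (F : ℂ → ℂ) (b : ℝ)
    (hder : ∀ z : ℂ, 0 < z.im → HasDerivAt F (-2 * W a n p z) z)
    (hcont : ∀ x : ℝ, (x < a 0 ∨ b < x) → ContinuousAt F x)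
    (hlim : Tendsto (fun t : ℝ => F ((a 0 - t : ℝ) : ℂ)) (nhdsWithin 0 (Ioi 0)) (nhds (1 / 2))) :
    (∀ q : ℝ, Tendsto (fun ε : ℝ => F (q + ε * I)) (nhdsWithin 0 (Ioi 0))
      (nhds (1 / 2 - 2 * ∫ x in a 0..q, W a n p x))) ∧
    (∀ x : ℝ, (x < a 0 ∨ b < x) → F x = 1 / 2 - 2 * ∫ y in a 0..x, W a n p y) := by
  have hvert : ∀ x : ℝ, Tendsto (fun ε : ℝ => (x + ε * I : ℂ)) (nhdsWithin 0 (Ioi 0)) (nhds (x : ℂ)) := by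
    intro x
    have : Continuous (fun ε : ℝ => (x + ε * I : ℂ)) := by fun_prop
    have h3 := this.tendsto 0
    simp only [ofReal_zero, zero_mul, add_zero] at h3
    exact h3.mono_left nhdsWithin_le_nhds
  have hI := W_integrable hmono p
  have hftc : ∀ u v ε : ℝ, 0 < ε →
      F (v + ε * I) = F (u + ε * I) + (-2) * ∫ x in u..v, W a n p (x + ε * I : ℂ) := by
    intro u v ε hε
    have him : ∀ x : ℝ, 0 < (x + ε * I : ℂ).im := fun x => by simpa using hε
    have hc : Continuous (fun x : ℝ => -2 * W a n p (x + ε * I : ℂ)) := by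
      refine continuous_const.mul ?_
      rw [continuous_iff_continuousAt]
      intro x
      exact ContinuousAt.comp (f := fun x : ℝ => (x + ε * I : ℂ)) (g := W a n p)
        (W_diff p (fun j _ => ne_of_im_pos (him x) _) (him x).le).continuousAt (by fun_prop)
    have := intervalIntegral.integral_eq_sub_of_hasDerivAt (a := u) (b := v)
      (f := fun x : ℝ => F (x + ε * I)) (f' := fun x : ℝ => -2 * W a n p (x + ε * I : ℂ)) ?_
      (hc.intervalIntegrable _ _)
    · rw [intervalIntegral.integral_const_mul] at this
      rw [this]; ring
    · intro x _
      have h1 := hder _ (him x)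
      have h2 : HasDerivAt (fun x : ℝ => (x + ε * I : ℂ)) 1 x :=
        (ofRealCLM.hasDerivAt (x := x)).add_const _
      have h3 := HasDerivAt.comp x h1 h2
      rw [mul_one] at h3
      exact h3
  have key : ∀ u v : ℝ, (u < a 0 ∨ b < u) → Tendsto (fun ε : ℝ => F (v + ε * I)) (nhdsWithin 0 (Ioi 0))
      (nhds (F u + (-2) * ∫ x in u..v, W a n p x)) := by
    intro u v hu
    have h1 : Tendsto (fun ε : ℝ => F (u + ε * I)) (nhdsWithin 0 (Ioi 0)) (nhds (F u)) :=
      (hcont u hu).tendsto.comp (hvert u)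
    have h2 := h1.add ((tendsto_horizontal hmono p u v).const_mul (-2))
    refine h2.congr' ?_
    filter_upwards [self_mem_nhdsWithin] with ε hε
    exact (hftc u v ε hε).symm
  have hF0 : ∀ u : ℝ, u < a 0 → F u = 1 / 2 + 2 * ∫ x in u..a 0, W a n p x := by
    intro u hu
    have h1 : ∀ u' : ℝ, u' < a 0 → F u' = F u + (-2) * ∫ x in u..u', W a n p x := by
      intro u' hu'
      have e1 := key u u' (Or.inl hu)
      have e2 : Tendsto (fun ε : ℝ => F (u' + ε * I)) (nhdsWithin 0 (Ioi 0)) (nhds (F u')) :=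
        (hcont u' (Or.inl hu')).tendsto.comp (hvert u')
      exact tendsto_nhds_unique e2 e1
    have hprim := intervalIntegral.continuous_primitive hI u
    have h2 : Tendsto (fun t : ℝ => F u + (-2) * ∫ x in u..(a 0 - t), W a n p x) (nhdsWithin 0 (Ioi 0))
        (nhds (F u + (-2) * ∫ x in u..(a 0), W a n p x)) := by
      have : Continuous (fun t : ℝ => F u + (-2) * ∫ x in u..(a 0 - t), W a n p x) :=
        continuous_const.add (continuous_const.mul (hprim.comp (by fun_prop : Continuous fun t : ℝ => a 0 - t)))
      have h3 := this.tendsto 0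
      simp only [sub_zero] at h3
      exact h3.mono_left nhdsWithin_le_nhds
    have h3 : Tendsto (fun t : ℝ => F ((a 0 - t : ℝ) : ℂ)) (nhdsWithin 0 (Ioi 0))
        (nhds (F u + (-2) * ∫ x in u..(a 0), W a n p x)) := by
      refine h2.congr' ?_
      filter_upwards [self_mem_nhdsWithin] with t ht
      have ht' : (0:ℝ) < t := ht
      exact (h1 (a 0 - t) (by linarith)).symm
    have := tendsto_nhds_unique hlim h3
    rw [this]; ring
  have main : ∀ q : ℝ, Tendsto (fun ε : ℝ => F (q + ε * I)) (nhdsWithin 0 (Ioi 0))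
      (nhds (1 / 2 - 2 * ∫ x in a 0..q, W a n p x)) := by
    intro q
    have h := key (a 0 - 1) q (Or.inl (by linarith))
    rw [hF0 (a 0 - 1) (by linarith)] at h
    convert h using 2
    have := intervalIntegral.integral_add_adjacent_intervals (hI (a 0 - 1) (a 0)) (hI (a 0) q)
    rw [← this]; ring
  refine ⟨main, fun x hx => ?_⟩
  have e2 : Tendsto (fun ε : ℝ => F (x + ε * I)) (nhdsWithin 0 (Ioi 0)) (nhds (F x)) :=
    (hcont x hx).tendsto.comp (hvert x)
  exact tendsto_nhds_unique e2 (main x)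

lemma im_quot {k : ℂ → ℂ} {e : ℝ} (hk : AnalyticAt ℂ k e)
    (hreal : ∀ᶠ x : ℝ in nhds e, (k x).im = 0) (hne : (k e).re ≠ 0) :
    ∀ᶠ z : ℂ in nhds (e : ℂ), 0 < z.im → (k e).re * (k z / (z - e)).im < 0 := by
  obtain ⟨K, s, hs, hL⟩ := hk.hasStrictDerivAt.hasStrictFDerivAt.exists_lipschitzOnWith
  have hre : Tendsto (fun z : ℂ => z.re) (nhds (e : ℂ)) (nhds e) := by
    have := Complex.continuous_re.tendsto (e : ℂ); simpa using this
  have hre2 : Tendsto (fun z : ℂ => (z.re : ℂ)) (nhds (e : ℂ)) (nhds (e : ℂ)) :=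
    (Complex.continuous_ofReal.tendsto e).comp hre
  set κ := (k e).re with hκ
  have hκ2 : 0 < κ ^ 2 := by positivity
  have hkc : Tendsto (fun z => κ * (k z).re) (nhds (e : ℂ)) (nhds (κ * κ)) :=
    ((Complex.continuous_re.tendsto _).comp hk.continuousAt.tendsto).const_mul κ
  have ev1 : ∀ᶠ z in nhds (e : ℂ), κ ^ 2 / 2 < κ * (k z).re := by
    refine hkc.eventually (lt_mem_nhds (by nlinarith))
  have ev2 : ∀ᶠ z in nhds (e : ℂ), |κ| * K * |z.re - e| < κ ^ 2 / 2 := by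
    have : Tendsto (fun z : ℂ => |κ| * K * |z.re - e|) (nhds (e : ℂ)) (nhds (|κ| * K * |e - e|)) :=
      ((hre.sub_const e).abs).const_mul _
    refine this.eventually (gt_mem_nhds ?_)
    simp; positivity
  filter_upwards [hs, hre2.eventually hs, hre.eventually hreal, ev1, ev2] with z h1 h2 h3 h4 h5 hz
  have hlip : |(k z).im| ≤ K * z.im := by
    have := hL.dist_le_mul z h1 (z.re : ℂ) h2
    rw [dist_eq_norm, dist_eq_norm] at this
    have e1 : ‖z - (z.re : ℂ)‖ = z.im := by
      have : z - (z.re : ℂ) = z.im * I := by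
        apply Complex.ext <;> simp
      rw [this]; simp [abs_of_pos hz]
    rw [e1] at this
    refine le_trans ?_ this
    have h6 := Complex.abs_im_le_norm (k z - k z.re)
    rw [Complex.sub_im, h3, sub_zero] at h6
    exact h6
  have hzne : z - e ≠ 0 := by
    intro h
    have := congrArg Complex.im h
    simp at this; linarith
  have hN : 0 < normSq (z - e) := normSq_pos.2 hzne
  have hform : (k z / (z - e)).im = ((k z).im * (z.re - e) - (k z).re * z.im) / normSq (z - e) := by
    rw [Complex.div_im]; simp; ring
  rw [hform, ← mul_div_assoc]
  apply div_neg_of_neg_of_pos _ hN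
  have h7 : κ * ((k z).im * (z.re - e)) ≤ |κ| * K * |z.re - e| * z.im := by
    calc _ ≤ |κ * ((k z).im * (z.re - e))| := le_abs_self _
      _ = |κ| * |z.re - e| * |(k z).im| := by rw [abs_mul, abs_mul]; ring
      _ ≤ |κ| * |z.re - e| * (K * z.im) := by gcongr
      _ = _ := by ring
  nlinarith

lemma W_sq {a : ℕ → ℝ} {n : ℕ} (p : Polynomial ℂ) {J : ℕ} (hJ : J < n) {z : ℂ}
    (hz : ∀ j < n, z ≠ a j) :
    W a n p z ^ 2 = (p.eval z ^ 2 / ∏ j ∈ (Finset.range n).erase J, (z - (a j : ℂ))) / (z - a J) := by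
  unfold W
  rw [div_pow, S_sq hz, div_div, mul_comm, Finset.mul_prod_erase _ (fun j => z - (a j : ℂ)) (Finset.mem_range.2 hJ)]

lemma sep {a : ℕ → ℝ} {n : ℕ} (hmono : ∀ i j, i < j → j < n → a i < a j) {J : ℕ} (hJ : J < n)
    {j : ℕ} (hj : j < n) (hjJ : j ≠ J) : a J ≠ a j := by
  rcases lt_or_gt_of_ne hjJ with h | h
  · exact (hmono _ _ h hJ).ne'
  · exact (hmono _ _ h hj).ne

lemma sign_endpoint {a : ℕ → ℝ} {n : ℕ} (hmono : ∀ i j, i < j → j < n → a i < a j)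
    (p : Polynomial ℂ) (hp : ∀ x : ℝ, (p.eval (x : ℂ)).im = 0) {J : ℕ} (hJ : J < n)
    (hpJ : p.eval (a J : ℂ) ≠ 0) {s σ δ₀ : ℝ} (hs : s = 1 ∨ s = -1) (hσ : σ = 1 ∨ σ = -1)
    (hδ₀ : 0 < δ₀)
    (harc : ∀ x : ℝ, |x - a J| < δ₀ → s * (x - a J) < 0 →
      σ * (W a n p x).im < 0 ∧ (W a n p x).re = 0) :
    ∃ δ > 0, (∀ z ∈ Metric.ball (a J : ℂ) δ, 0 < z.im → σ * (W a n p z).im < 0) ∧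
      ∀ x : ℝ, |x - a J| < δ → 0 < s * (x - a J) → 0 < s * σ * (W a n p x).re := by
  set e := a J with he
  have hs2 : s * s = 1 := by rcases hs with h | h <;> rw [h] <;> norm_num
  have hσ2 : σ * σ = 1 := by rcases hσ with h | h <;> rw [h] <;> norm_num
  set k : ℂ → ℂ := fun z => p.eval z ^ 2 / ∏ j ∈ (Finset.range n).erase J, (z - (a j : ℂ)) with hk
  have hden : ∏ j ∈ (Finset.range n).erase J, ((e : ℂ) - (a j : ℂ)) ≠ 0 := by
    refine Finset.prod_ne_zero_iff.2 fun j hj => ?_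
    rw [Finset.mem_erase, Finset.mem_range] at hj
    exact sub_ne_zero.2 (by exact_mod_cast sep hmono hJ hj.2 hj.1)
  have hkan : AnalyticAt ℂ k e := by
    refine AnalyticAt.div ?_ ?_ hden
    · have : Differentiable ℂ (fun z => p.eval z) := p.differentiable
      exact (this.analyticAt _).pow 2
    · have : Differentiable ℂ (fun z : ℂ => ∏ j ∈ (Finset.range n).erase J, (z - (a j : ℂ))) := by
        intro z
        exact DifferentiableAt.fun_finsetProd fun j _ => by fun_prop
      exact this.analyticAt _
  have hkreal : ∀ x : ℝ, (k x).im = 0 := by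
    intro x
    have e1 : p.eval (x : ℂ) = ((p.eval (x : ℂ)).re : ℂ) := by
      apply Complex.ext <;> simp [hp x]
    have : k x = (((p.eval (x : ℂ)).re ^ 2 / ∏ j ∈ (Finset.range n).erase J, (x - a j) : ℝ) : ℂ) := by
      simp only [hk]
      rw [e1]
      push_cast
      rfl
    rw [this]; exact ofReal_im _
  have hkne : k e ≠ 0 := div_ne_zero (pow_ne_zero _ hpJ) hden
  have hκne : (k e).re ≠ 0 := by
    intro h
    exact hkne (Complex.ext h (by simpa using hkreal e))
  -- separation from the other points
  have hsep : ∀ᶠ z : ℂ in nhds (e : ℂ), ∀ j < n, z ≠ a j ∨ j = J := by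
    have : ∀ᶠ z : ℂ in nhds (e : ℂ), ∀ j ∈ Finset.range n, (z ≠ a j ∨ j = J) := by
      rw [Filter.eventually_all_finset]
      intro j hj
      by_cases h : j = J
      · simp [h]
      · have : (e : ℂ) ≠ a j := by exact_mod_cast sep hmono hJ (Finset.mem_range.1 hj) h
        filter_upwards [isOpen_ne.mem_nhds this] with z hz
        exact Or.inl hz
    filter_upwards [this] with z hz j hj
    exact hz j (Finset.mem_range.2 hj)
  obtain ⟨δ₁, hδ₁, hb₁⟩ := Metric.eventually_nhds_iff_ball.1 hsep
  have hreal_mem : ∀ {x δ : ℝ}, |x - e| < δ → (x : ℂ) ∈ Metric.ball (e : ℂ) δ := by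
    intro x δ h
    rw [Metric.mem_ball, dist_eq_norm, ← ofReal_sub, Complex.norm_real]
    exact h
  have hWx : ∀ x : ℝ, |x - e| < δ₁ → x ≠ e → W a n p x ^ 2 = k x / (x - e) := by
    intro x hx hxe
    apply W_sq p hJ
    intro j hj
    rcases hb₁ x (hreal_mem hx) j hj with h | h
    · exact h
    · rw [h]; exact_mod_cast hxe
  have hkx : ∀ x : ℝ, |x - e| < δ₀ → |x - e| < δ₁ → s * (x - e) < 0 → 0 < s * (k x).re := by
    intro x h0 h1 h2
    have hxe : x - e ≠ 0 := by
      intro h; rw [h] at h2; simp at h2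
    obtain ⟨q1, q2⟩ := harc x h0 h2
    have h3 := hWx x h1 (sub_ne_zero.1 hxe)
    have h4 : k x = W a n p x ^ 2 * (x - e) := by
      rw [h3]; field_simp [show ((x:ℂ) - e) ≠ 0 by exact_mod_cast hxe]
    have h5 : (k x).re = -(W a n p x).im ^ 2 * (x - e) := by
      rw [h4]
      have : ((x : ℂ) - e) = ((x - e : ℝ) : ℂ) := by push_cast; rfl
      rw [this, Complex.re_mul_ofReal, pow_two, Complex.mul_re, q2]; ring
    have h6 : (W a n p x).im ≠ 0 := by
      intro h; rw [h] at q1; simp at q1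
    have h7 : 0 < (W a n p x).im ^ 2 := by positivity
    rw [h5]; nlinarith
  set t₀ := min δ₀ δ₁ with ht₀
  have ht₀p : 0 < t₀ := lt_min hδ₀ hδ₁
  -- approach the endpoint along the arc
  have hpt : ∀ t : ℝ, 0 < t → |e - s * t - e| = t ∧ s * (e - s * t - e) < 0 := by
    intro t ht
    have : e - s * t - e = - (s * t) := by ring
    rw [this, abs_neg, abs_mul]
    refine ⟨?_, by nlinarith⟩
    rcases hs with h | h <;> rw [h] <;> simp [abs_of_pos ht]
  have hκs : 0 < s * (k e).re := by
    have hlim : Tendsto (fun t : ℝ => s * (k ((e - s * t : ℝ) : ℂ)).re) (nhdsWithin 0 (Ioi 0))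
        (nhds (s * (k e).re)) := by
      have hc : ContinuousAt (fun t : ℝ => s * (k ((e - s * t : ℝ) : ℂ)).re) 0 := by
        have h1 : ContinuousAt k (((e - s * (0:ℝ) : ℝ)) : ℂ) := by simpa using hkan.continuousAt
        have h2 : ContinuousAt (fun t : ℝ => k ((e - s * t : ℝ) : ℂ)) 0 :=
          ContinuousAt.comp (f := fun t : ℝ => ((e - s * t : ℝ) : ℂ)) (g := k) h1 (by fun_prop)
        exact continuousAt_const.mul (Complex.continuous_re.continuousAt.comp h2)
      have := hc.tendsto
      simp only [mul_zero, sub_zero] at this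
      exact this.mono_left nhdsWithin_le_nhds
    have hge : 0 ≤ s * (k e).re := by
      refine ge_of_tendsto hlim ?_
      filter_upwards [Ioo_mem_nhdsGT ht₀p] with t ht
      obtain ⟨h1, h2⟩ := hpt t ht.1
      exact (hkx _ (by rw [h1]; exact ht.2.trans_le (min_le_left _ _))
        (by rw [h1]; exact ht.2.trans_le (min_le_right _ _)) h2).le
    have hsne : s ≠ 0 := by rintro rfl; simp at hs2
    exact lt_of_le_of_ne hge (mul_ne_zero hsne hκne).symm
  have hIm := im_quot hkan (Eventually.of_forall hkreal) hκne
  have hkpos : ∀ᶠ z : ℂ in nhds (e : ℂ), 0 < s * (k z).re := by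
    have : Tendsto (fun z => s * (k z).re) (nhds (e : ℂ)) (nhds (s * (k e).re)) :=
      ((Complex.continuous_re.tendsto _).comp hkan.continuousAt.tendsto).const_mul s
    exact this.eventually (lt_mem_nhds hκs)
  obtain ⟨δ₂, hδ₂, hb₂⟩ := Metric.eventually_nhds_iff_ball.1 (hIm.and hkpos)
  set δ := min t₀ δ₂ with hδ
  have hδp : 0 < δ := lt_min ht₀p hδ₂
  have hδδ₁ : δ ≤ δ₁ := (min_le_left _ _).trans (min_le_right _ _)
  have hδδ₀ : δ ≤ δ₀ := (min_le_left _ _).trans (min_le_left _ _)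
  have hδδ₂ : δ ≤ δ₂ := min_le_right _ _
  have hWc : ∀ x : ℝ, |x - e| < δ₁ → x ≠ e → ContinuousAt (W a n p) x := by
    intro x hx hxe
    refine (W_diff p ?_ (by simp)).continuousAt
    intro j hj
    rcases hb₁ x (hreal_mem hx) j hj with h | h
    · exact h
    · rw [h]; exact_mod_cast hxe
  have hvert : ∀ x : ℝ, Tendsto (fun ε : ℝ => (x + ε * I : ℂ)) (nhdsWithin 0 (Ioi 0)) (nhds (x : ℂ)) := by
    intro x
    have : Continuous (fun ε : ℝ => (x + ε * I : ℂ)) := by fun_prop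
    have h3 := this.tendsto 0
    simp only [ofReal_zero, zero_mul, add_zero] at h3
    exact h3.mono_left nhdsWithin_le_nhds
  have hprod : ∀ z ∈ Metric.ball (e : ℂ) δ, 0 < z.im → s * ((W a n p z).re * (W a n p z).im) < 0 := by
    intro z hz hzi
    have h1 := (hb₂ z (Metric.ball_subset_ball hδδ₂ hz)).1 hzi
    have h2 : W a n p z ^ 2 = k z / (z - e) := W_sq p hJ fun j _ => ne_of_im_pos hzi _
    rw [← h2, pow_two, Complex.mul_im] at h1
    have h3 : s * (k e).re * (s * ((W a n p z).re * (W a n p z).im)) < 0 := by nlinarith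
    exact (pos_iff_neg_of_mul_neg h3).1 hκs
  have hconv : IsPreconnected (Metric.ball (e : ℂ) δ ∩ {z : ℂ | 0 < z.im}) :=
    ((convex_ball _ _).inter (convex_halfSpace_im_gt 0)).isPreconnected
  -- a good point
  obtain ⟨z₀, hz₀b, hz₀i, hz₀⟩ : ∃ z₀ ∈ Metric.ball (e : ℂ) δ, 0 < z₀.im ∧ σ * (W a n p z₀).im < 0 := by
    obtain ⟨h1, h2⟩ := hpt (δ / 2) (by linarith)
    set x := e - s * (δ / 2) with hx
    have hxδ : |x - e| < δ := by rw [h1]; linarith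
    have hxe : x ≠ e := by
      intro h; rw [h] at h2; simp at h2
    have h3 := (harc x (hxδ.trans_le hδδ₀) h2).1
    have h4 : Tendsto (fun ε : ℝ => σ * (W a n p (x + ε * I : ℂ)).im) (nhdsWithin 0 (Ioi 0))
        (nhds (σ * (W a n p x).im)) :=
      ((Complex.continuous_im.tendsto _).comp
        ((hWc x (hxδ.trans_le hδδ₁) hxe).tendsto.comp (hvert x))).const_mul σ
    have h5 := h4.eventually (gt_mem_nhds h3)
    have h6 := (hvert x).eventually (Metric.isOpen_ball.mem_nhds (hreal_mem hxδ))
    obtain ⟨ε, h7, h8, h9⟩ := (h5.and (h6.and self_mem_nhdsWithin)).exists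
    exact ⟨_, h8, by simpa using h9, h7⟩
  have hmain : ∀ z ∈ Metric.ball (e : ℂ) δ, 0 < z.im → σ * (W a n p z).im < 0 := by
    intro z hz hzi
    by_contra hcon
    push Not at hcon
    have hcont : ContinuousOn (fun z => σ * (W a n p z).im)
        (Metric.ball (e : ℂ) δ ∩ {z : ℂ | 0 < z.im}) := by
      intro w hw
      have hwi : 0 < w.im := hw.2
      have := (W_diff (a := a) (n := n) p (fun j _ => ne_of_im_pos hwi _) hwi.le).continuousAt
      exact (continuousAt_const.mul (Complex.continuous_im.continuousAt.comp this)).continuousWithinAt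
    have := hconv.intermediate_value ⟨hz₀b, hz₀i⟩ ⟨hz, hzi⟩ hcont
    obtain ⟨w, hw, hw0⟩ := this ⟨hz₀.le, hcon⟩
    have h1 := hprod w hw.1 hw.2
    have hσne : σ ≠ 0 := by rintro rfl; simp at hσ2
    have h2 : (W a n p w).im = 0 := by
      rcases mul_eq_zero.1 hw0 with h | h
      · exact absurd h hσne
      · exact h
    rw [h2] at h1; simp at h1
  refine ⟨δ, hδp, hmain, ?_⟩
  intro x hx hsx
  have hxe : x ≠ e := by
    intro h; rw [h] at hsx; simp at hsx
  have hge : 0 ≤ s * σ * (W a n p x).re := by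
    have h4 : Tendsto (fun ε : ℝ => s * σ * (W a n p (x + ε * I : ℂ)).re) (nhdsWithin 0 (Ioi 0))
        (nhds (s * σ * (W a n p x).re)) :=
      ((Complex.continuous_re.tendsto _).comp
        ((hWc x (hx.trans_le hδδ₁) hxe).tendsto.comp (hvert x))).const_mul _
    refine ge_of_tendsto h4 ?_
    have h6 := (hvert x).eventually (Metric.isOpen_ball.mem_nhds (hreal_mem hx))
    filter_upwards [h6, self_mem_nhdsWithin] with ε h7 h8
    have hi : 0 < (x + ε * I : ℂ).im := by simpa using h8
    have q1 := hmain _ h7 hi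
    have q2 := hprod _ h7 hi
    set u := (W a n p (x + ε * I : ℂ)).re
    set v := (W a n p (x + ε * I : ℂ)).im
    have h9 : (σ * v) * (s * σ * u) < 0 := by
      have : (σ * v) * (s * σ * u) = (σ * σ) * (s * (u * v)) := by ring
      rw [this, hσ2]; linarith
    exact ((neg_iff_pos_of_mul_neg h9).1 q1).le
  refine lt_of_le_of_ne hge ?_
  intro h0
  have hsne : s ≠ 0 := by rintro rfl; simp at hs2
  have hσne : σ ≠ 0 := by rintro rfl; simp at hσ2
  have hre0 : (W a n p x).re = 0 := by
    rcases mul_eq_zero.1 h0.symm with h | h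
    · exact absurd h (mul_ne_zero hsne hσne)
    · exact h
  have h3 := hWx x (hx.trans_le hδδ₁) hxe
  have h4 : k x = W a n p x ^ 2 * (x - e) := by
    rw [h3]; field_simp [show ((x:ℂ) - e) ≠ 0 from sub_ne_zero.2 (by exact_mod_cast hxe)]
  have h5 : (k x).re = -(W a n p x).im ^ 2 * (x - e) := by
    rw [h4]
    have : ((x : ℂ) - e) = ((x - e : ℝ) : ℂ) := by push_cast; rfl
    rw [this, Complex.re_mul_ofReal, pow_two, Complex.mul_re, hre0]; ring
  have h6 := (hb₂ x (Metric.ball_subset_ball hδδ₂ (hreal_mem hx))).2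
  rw [h5] at h6
  nlinarith [sq_nonneg (W a n p x).im]

lemma arc_ne {a : ℕ → ℝ} {n : ℕ} (hmono : ∀ i j, i < j → j < n → a i < a j) {i : ℕ} (hi : i + 1 < n)
    {x : ℝ} (hx : x ∈ Ioo (a i) (a (i + 1))) : ∀ j < n, x ≠ a j := by
  intro j hj h
  rcases lt_trichotomy j i with h1 | h1 | h1
  · have := hmono j i h1 (by omega)
    linarith [hx.1]
  · rw [h1] at h; linarith [hx.1]
  · rcases (Nat.succ_le_of_lt h1).lt_or_eq with h2 | h2
    · have := hmono (i+1) j h2 hj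
      linarith [hx.2]
    · have h3 : j = i + 1 := by omega
      rw [h3] at h; linarith [hx.2]

lemma sign_local {a : ℕ → ℝ} {n : ℕ} (hmono : ∀ i j, i < j → j < n → a i < a j)
    (p : Polynomial ℂ) (hp : ∀ x : ℝ, (p.eval (x : ℂ)).im = 0) {i : ℕ} (hi : i + 1 < n)
    (hpc : p.eval (a i : ℂ) ≠ 0) (hpd : p.eval (a (i + 1) : ℂ) ≠ 0) {σ : ℝ}
    (hσ : σ = 1 ∨ σ = -1)
    (harc : ∀ x ∈ Ioo (a i) (a (i + 1)), σ * (W a n p x).im < 0 ∧ (W a n p x).re = 0)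
    {x₀ : ℝ} (hx₀ : x₀ ∈ Icc (a i) (a (i + 1))) :
    ∃ δ > 0, (∀ z ∈ Metric.ball (x₀ : ℂ) δ, 0 < z.im → σ * (W a n p z).im < 0) ∧
      ∀ x : ℝ, |x - x₀| < δ → (x < a i → σ * (W a n p x).re < 0) ∧
        (a (i + 1) < x → 0 < σ * (W a n p x).re) := by
  have hcd : a i < a (i + 1) := hmono _ _ (by omega) hi
  rcases eq_or_lt_of_le hx₀.1 with h | h
  · -- left endpoint
    subst h
    obtain ⟨δ, hδ, h1, h2⟩ := sign_endpoint hmono p hp (J := i) (by omega) hpc (s := -1) (σ := σ)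
      (δ₀ := a (i+1) - a i) (Or.inr rfl) hσ (by linarith) (by
        intro x hx hs
        apply harc
        rw [abs_lt] at hx
        constructor <;> linarith)
    refine ⟨min δ (a (i+1) - a i), lt_min hδ (by linarith), fun z hz => h1 z (Metric.ball_subset_ball (min_le_left _ _) hz), ?_⟩
    intro x hx
    refine ⟨fun hxi => ?_, fun hxi => ?_⟩
    · have := h2 x (hx.trans_le (min_le_left _ _)) (by linarith)
      linarith
    · have := hx.trans_le (min_le_right _ _)
      rw [abs_lt] at this; linarith
  rcases eq_or_lt_of_le hx₀.2 with h' | h'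
  · subst h'
    obtain ⟨δ, hδ, h1, h2⟩ := sign_endpoint hmono p hp (J := i+1) hi hpd (s := 1) (σ := σ)
      (δ₀ := a (i+1) - a i) (Or.inl rfl) hσ (by linarith) (by
        intro x hx hs
        apply harc
        rw [abs_lt] at hx
        constructor <;> linarith)
    refine ⟨min δ (a (i+1) - a i), lt_min hδ (by linarith), fun z hz => h1 z (Metric.ball_subset_ball (min_le_left _ _) hz), ?_⟩
    intro x hx
    refine ⟨fun hxi => ?_, fun hxi => ?_⟩
    · have := hx.trans_le (min_le_right _ _)
      rw [abs_lt] at this; linarith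
    · have := h2 x (hx.trans_le (min_le_left _ _)) (by linarith)
      linarith
  · have hc : ContinuousAt (W a n p) x₀ := by
      refine (W_diff p ?_ (by simp)).continuousAt
      intro j hj h2
      exact arc_ne hmono hi ⟨h, h'⟩ j hj (by exact_mod_cast h2)
    have hlim : Tendsto (fun z => σ * (W a n p z).im) (nhds (x₀ : ℂ)) (nhds (σ * (W a n p x₀).im)) :=
      ((Complex.continuous_im.tendsto _).comp hc.tendsto).const_mul σ
    obtain ⟨δ, hδ, h1⟩ := Metric.eventually_nhds_iff_ball.1
      (hlim.eventually (gt_mem_nhds (harc x₀ ⟨h, h'⟩).1))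
    refine ⟨min δ (min (x₀ - a i) (a (i+1) - x₀)), lt_min hδ (lt_min (by linarith) (by linarith)),
      fun z hz _ => h1 z (Metric.ball_subset_ball (min_le_left _ _) hz), ?_⟩
    intro x hx
    have h2 := hx.trans_le ((min_le_right _ _).trans (min_le_left _ _))
    have h3 := hx.trans_le ((min_le_right _ _).trans (min_le_right _ _))
    rw [abs_lt] at h2 h3
    exact ⟨fun _ => by linarith, fun _ => by linarith⟩

lemma re_integral {a : ℕ → ℝ} {n : ℕ} (hmono : ∀ i j, i < j → j < n → a i < a j)
    (p : Polynomial ℂ) (u v : ℝ) :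
    (∫ x in u..v, W a n p x).re = ∫ x in u..v, (W a n p x).re := by
  have := Complex.reCLM.intervalIntegral_comp_comm (W_integrable hmono p u v)
  simpa using this.symm

lemma re_integrable {a : ℕ → ℝ} {n : ℕ} (hmono : ∀ i j, i < j → j < n → a i < a j)
    (p : Polynomial ℂ) (u v : ℝ) :
    IntervalIntegrable (fun x : ℝ => (W a n p x).re) MeasureTheory.volume u v := by
  have h := W_integrable hmono p u v
  exact ⟨h.1.re, h.2.re⟩

lemma local_up {a : ℕ → ℝ} {n : ℕ} (hmono : ∀ i j, i < j → j < n → a i < a j)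
    (p : Polynomial ℂ) (hp : ∀ x : ℝ, (p.eval (x : ℂ)).im = 0) {i : ℕ} (hi : i + 1 < n)
    (hpc : p.eval (a i : ℂ) ≠ 0) (hpd : p.eval (a (i + 1) : ℂ) ≠ 0) {σ : ℝ}
    (hσ : σ = 1 ∨ σ = -1)
    (harc : ∀ x ∈ Ioo (a i) (a (i + 1)), σ * (W a n p x).im < 0 ∧ (W a n p x).re = 0)
    (F : ℂ → ℂ)
    (hder : ∀ z : ℂ, 0 < z.im → HasDerivAt F (-2 * W a n p z) z)
    (hbd : ∀ q : ℝ, Tendsto (fun ε : ℝ => F (q + ε * I)) (nhdsWithin 0 (Ioi 0))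
      (nhds (1 / 2 - 2 * ∫ x in a 0..q, W a n p x)))
    (hval : ∀ x ∈ Icc (a i) (a (i + 1)), σ * (1 / 2 - 2 * ∫ y in a 0..x, W a n p y).re = 1 / 2)
    {x₀ : ℝ} (hx₀ : x₀ ∈ Icc (a i) (a (i + 1))) :
    ∃ δ > 0, (∀ z ∈ Metric.ball (x₀ : ℂ) δ, 0 < z.im → σ * (F z).re < 1 / 2) ∧
      ∀ x : ℝ, |x - x₀| < δ → x ∉ Icc (a i) (a (i + 1)) →
        σ * (1 / 2 - 2 * ∫ y in a 0..x, W a n p y).re < 1 / 2 := by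
  obtain ⟨δ, hδ, h1, h2⟩ := sign_local hmono p hp hi hpc hpd hσ harc hx₀
  have hcd : a i < a (i + 1) := hmono _ _ (by omega) hi
  have hI := W_integrable hmono p
  have hout : ∀ x : ℝ, |x - x₀| < δ → x ∉ Icc (a i) (a (i + 1)) →
        σ * (1 / 2 - 2 * ∫ y in a 0..x, W a n p y).re < 1 / 2 := by
    intro x hx hxn
    rcases lt_or_ge x (a i) with hxi | hxi
    · have hv := hval (a i) ⟨le_rfl, hcd.le⟩
      have hadd := intervalIntegral.integral_add_adjacent_intervals (hI (a 0) x) (hI x (a i))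
      rw [← hadd] at hv
      have hpos : 0 < ∫ y in x..(a i), (-σ) * (W a n p y).re := by
        refine intervalIntegral.intervalIntegral_pos_of_pos_on
          ((re_integrable hmono p _ _).const_mul _) ?_ hxi
        intro y hy
        have := (h2 y (by rw [abs_lt] at hx ⊢; constructor <;> linarith [hy.1, hy.2, hx₀.1])).1 hy.2
        linarith
      rw [intervalIntegral.integral_const_mul, ← re_integral hmono] at hpos
      simp at hv ⊢
      nlinarith
    · have hxi2 : a (i+1) < x := by
        by_contra h; push Not at h; exact hxn ⟨hxi, h⟩
      have hv := hval (a (i+1)) ⟨hcd.le, le_rfl⟩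
      have hadd := intervalIntegral.integral_add_adjacent_intervals (hI (a 0) (a (i+1))) (hI (a (i+1)) x)
      rw [← hadd]
      have hpos : 0 < ∫ y in (a (i+1))..x, σ * (W a n p y).re := by
        refine intervalIntegral.intervalIntegral_pos_of_pos_on
          ((re_integrable hmono p _ _).const_mul _) ?_ hxi2
        intro y hy
        exact (h2 y (by rw [abs_lt] at hx ⊢; constructor <;> linarith [hy.1, hy.2, hx₀.2])).2 hy.1
      rw [intervalIntegral.integral_const_mul, ← re_integral hmono] at hpos
      simp at hv ⊢
      nlinarith
  refine ⟨δ, hδ, ?_, hout⟩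
  intro z hz hzi
  set x := z.re with hx
  set y := z.im with hy
  have hzx : |x - x₀| < δ := by
    rw [Metric.mem_ball, dist_eq_norm] at hz
    refine lt_of_le_of_lt ?_ hz
    have := Complex.abs_re_le_norm (z - x₀)
    simpa using this
  have hle : σ * (1 / 2 - 2 * ∫ t in a 0..x, W a n p t).re ≤ 1 / 2 := by
    by_cases hm : x ∈ Icc (a i) (a (i + 1))
    · exact (hval x hm).le
    · exact (hout x hzx hm).le
  have hmem : ∀ t : ℝ, 0 < t → t ≤ y → (x + t * I : ℂ) ∈ Metric.ball (x₀ : ℂ) δ := by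
    intro t ht hty
    rw [Metric.mem_ball, dist_eq_norm] at hz ⊢
    refine lt_of_le_of_lt ?_ hz
    rw [← sq_le_sq₀ (norm_nonneg _) (norm_nonneg _), ← Complex.normSq_eq_norm_sq,
      ← Complex.normSq_eq_norm_sq, Complex.normSq_apply, Complex.normSq_apply]
    simp
    nlinarith
  set f : ℝ → ℝ := fun t => σ * (F (x + t * I)).re with hf
  have hfd : ∀ t : ℝ, 0 < t → HasDerivAt f (2 * (σ * (W a n p (x + t * I : ℂ)).im)) t := by
    intro t ht
    have him : 0 < (x + t * I : ℂ).im := by simpa using ht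
    have d1 := hder _ him
    have d2 : HasDerivAt (fun t : ℝ => (x + t * I : ℂ)) I t := by
      have := ((ofRealCLM.hasDerivAt (x := t)).mul_const I).const_add (x : ℂ)
      simpa using this
    have d3 : HasDerivAt (fun t : ℝ => F (x + t * I)) (-2 * W a n p (x + t * I : ℂ) * I) t :=
      HasDerivAt.comp t d1 d2
    have d4 := (Complex.reCLM.hasFDerivAt.comp_hasDerivAt t d3).const_mul σ
    have e4 : σ * reCLM (-2 * W a n p (x + t * I : ℂ) * I) = 2 * (σ * (W a n p (x + t * I : ℂ)).im) := by
      simp; ring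
    rw [e4] at d4
    exact d4
  have hanti : StrictAntiOn f (Ioc 0 y) := by
    apply strictAntiOn_of_deriv_neg (convex_Ioc 0 y)
    · intro t ht
      exact (hfd t ht.1).continuousAt.continuousWithinAt
    · intro t ht
      rw [interior_Ioc] at ht
      rw [(hfd t ht.1).deriv]
      have := h1 _ (hmem t ht.1 ht.2.le) (by simpa using ht.1)
      linarith
  have hflim : Tendsto f (nhdsWithin 0 (Ioi 0)) (nhds (σ * (1 / 2 - 2 * ∫ t in a 0..x, W a n p t).re)) :=
    ((Complex.continuous_re.tendsto _).comp (hbd x)).const_mul σ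
  have hhalf : f (y / 2) ≤ σ * (1 / 2 - 2 * ∫ t in a 0..x, W a n p t).re := by
    refine ge_of_tendsto hflim ?_
    filter_upwards [Ioo_mem_nhdsGT (show (0:ℝ) < y / 2 by linarith)] with t ht
    exact (hanti ⟨ht.1, by linarith [ht.2]⟩ ⟨by linarith, by linarith⟩ ht.2).le
  have hlt : f y < f (y / 2) := hanti ⟨by linarith, by linarith⟩ ⟨hzi, le_rfl⟩ (by linarith)
  have hfz : f y = σ * (F z).re := by
    simp only [hf]
    rw [hx, hy, Complex.re_add_im]
  rw [← hfz]
  linarith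

lemma upper_preconn : IsPreconnected {z : ℂ | 0 < z.im} := by
  have : Convex ℝ {z : ℂ | 0 < z.im} := convex_halfSpace_im_gt 0
  exact this.isPreconnected

lemma half_eq {a : ℕ → ℝ} {n : ℕ} {T : ℂ → ℂ} (hT : ContinuousOn T {z : ℂ | 0 < z.im})
    (hsq : ∀ z : ℂ, 0 < z.im → T z ^ 2 = ∏ j ∈ Finset.range n, (z - (a j : ℂ)))
    {x₀ : ℝ} (hx₀ : ∀ j < n, a j < x₀) (hc : ContinuousAt T x₀) :
    ∃ ε : ℂ, (ε = 1 ∨ ε = -1) ∧ (∀ z : ℂ, 0 < z.im → T z = ε * S a n z) ∧ T x₀ = ε * S a n x₀ := by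
  have hS : ContinuousOn (S a n) {z : ℂ | 0 < z.im} := fun z hz =>
    (S_diff (fun j _ => ne_of_im_pos hz (a j)) (le_of_lt hz)).continuousAt.continuousWithinAt
  have hlim : Tendsto (fun ε : ℝ => (x₀ + ε * I : ℂ)) (nhdsWithin 0 (Ioi 0)) (nhds (x₀ : ℂ)) := by
    have : Continuous (fun ε : ℝ => (x₀ + ε * I : ℂ)) := by fun_prop
    have h := this.tendsto 0
    simp only [ofReal_zero, zero_mul, add_zero] at h
    exact h.mono_left nhdsWithin_le_nhds
  have hSc : ContinuousAt (S a n) x₀ :=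
    (S_diff (fun j hj => by exact_mod_cast (hx₀ j hj).ne') (by simp)).continuousAt
  have key : ∃ ε : ℂ, (ε = 1 ∨ ε = -1) ∧ (∀ z : ℂ, 0 < z.im → T z = ε * S a n z) := by
    rcases upper_preconn.eq_or_eq_neg_of_sq_eq hT hS (fun z hz => by
        simp only [Pi.pow_apply]
        rw [hsq z hz, S_sq (fun j _ => ne_of_im_pos hz (a j))]) (fun _ => S_ne _ _ _) with h | h
    · exact ⟨1, Or.inl rfl, fun z hz => by rw [h hz, one_mul]⟩
    · exact ⟨-1, Or.inr rfl, fun z hz => by rw [h hz]; simp⟩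
  obtain ⟨ε, hε, h⟩ := key
  refine ⟨ε, hε, h, ?_⟩
  have t1 := hc.tendsto.comp hlim
  have t2 := (hSc.tendsto.comp hlim).const_mul ε
  refine tendsto_nhds_unique t1 (t2.congr' ?_)
  filter_upwards [self_mem_nhdsWithin] with e he
  simp only [Function.comp]
  rw [h]
  simpa using he

lemma R_eq {a : ℕ → ℝ} {n : ℕ} {R : ℂ → ℂ} {A : Set ℂ} (hA : IsClosed A) (hAr : ∀ z ∈ A, z.im = 0)
    (hR : DifferentiableOn ℂ R Aᶜ)
    (hsq : ∀ z ∉ A, R z ^ 2 = ∏ j ∈ Finset.range n, (z - (a j : ℂ)))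
    {x₀ : ℝ} (hx₀ : ∀ j < n, a j < x₀) (hxA : (x₀ : ℂ) ∉ A) :
    ∃ ε : ℂ, (ε = 1 ∨ ε = -1) ∧ (∀ z : ℂ, 0 < z.im → R z = ε * S a n z) ∧
      (∀ z : ℂ, 0 < z.im → (starRingEnd ℂ) (R ((starRingEnd ℂ) z)) = ε * S a n z) := by
  have hca : ∀ z ∉ A, ContinuousAt R z := fun z hz =>
    (hR.differentiableAt (hA.isOpen_compl.mem_nhds hz)).continuousAt
  have hnA : ∀ z : ℂ, z.im ≠ 0 → z ∉ A := fun z hz h => hz (hAr z h)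
  obtain ⟨ε, hε, h1, h2⟩ := half_eq (a := a) (n := n) (T := R)
    (fun z hz => (hca z (hnA z (ne_of_gt hz))).continuousWithinAt)
    (fun z hz => hsq z (hnA z (ne_of_gt hz))) hx₀ (hca _ hxA)
  obtain ⟨ε', hε', h1', h2'⟩ := half_eq (a := a) (n := n)
    (T := fun z => (starRingEnd ℂ) (R ((starRingEnd ℂ) z)))
    (fun z hz => by
      have hz' : ((starRingEnd ℂ) z) ∉ A := hnA _ (by
        have : 0 < z.im := hz
        simp; exact this.ne')
      have : ContinuousAt (fun z => (starRingEnd ℂ) (R ((starRingEnd ℂ) z))) z :=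
        Complex.continuous_conj.continuousAt.comp
          (ContinuousAt.comp (g := R) (hca _ hz') Complex.continuous_conj.continuousAt)
      exact this.continuousWithinAt)
    (fun z hz => by
      have hz' : ((starRingEnd ℂ) z) ∉ A := hnA _ (by simp; exact hz.ne')
      rw [← map_pow, hsq _ hz', map_prod]
      simp) hx₀
    (by
      have hz' : ((starRingEnd ℂ) (x₀:ℂ)) ∉ A := by simpa using hxA
      exact Complex.continuous_conj.continuousAt.comp
          (ContinuousAt.comp (g := R) (hca _ hz') Complex.continuous_conj.continuousAt))
  refine ⟨ε, hε, h1, ?_⟩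
  have hee : ε' = ε := by
    obtain ⟨ρ, hρ, hS⟩ := S_real (a := a) (n := n) (m := n) le_rfl hx₀ (fun j h1 h2 => by omega)
    simp only [Complex.conj_ofReal, h2] at h2'
    have hρ' : (ρ : ℂ) ≠ 0 := by exact_mod_cast hρ.ne'
    rw [hS] at h2'
    simp at h2'
    rcases h2' with h | h
    · rcases hε with rfl | rfl <;> simp at h <;> rw [← h]
    · exact absurd h hρ.ne'
  rw [← hee]; exact h1'

lemma S_int {a : ℕ → ℝ} {n : ℕ} (hmono : ∀ i j, i < j → j < n → a i < a j) {i : ℕ} (hi : i + 1 < n)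
    {x : ℝ} (hx : x ∈ Ioo (a i) (a (i + 1))) : ∃ ρ : ℝ, 0 < ρ ∧ S a n x = I ^ (n - (i + 1)) * ρ := by
  refine S_real hi.le (fun j hj => ?_) (fun j h1 h2 => ?_)
  · rcases (Nat.lt_succ_iff.1 hj).lt_or_eq with h | h
    · exact (hmono j i h (by omega)).trans hx.1
    · rw [h]; exact hx.1
  · rcases h1.lt_or_eq with h | h
    · exact hx.2.trans (hmono _ _ h h2)
    · rw [← h]; exact hx.2

lemma S_gap {a : ℕ → ℝ} {g : ℕ} (hmono : ∀ i j, i < j → j < 2 * g + 2 → a i < a j) {k : ℕ} (hk : k < g)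
    {x : ℝ} (hx : x ∈ Ioo (a (2 * k + 1)) (a (2 * k + 2))) :
    ∃ ρ : ℝ, 0 < ρ ∧ S a (2 * g + 2) x = (((-1) ^ (g - k) * ρ : ℝ) : ℂ) := by
  obtain ⟨ρ, h, e⟩ := S_int hmono (i := 2 * k + 1) (by omega) hx
  refine ⟨ρ, h, ?_⟩
  rw [e, show 2 * g + 2 - (2 * k + 1 + 1) = 2 * (g - k) by omega, pow_mul, I_sq]
  push_cast; ring

lemma S_arc {a : ℕ → ℝ} {g : ℕ} (hmono : ∀ i j, i < j → j < 2 * g + 2 → a i < a j) {k : ℕ} (hk : k ≤ g)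
    {x : ℝ} (hx : x ∈ Ioo (a (2 * k)) (a (2 * k + 1))) :
    ∃ ρ : ℝ, 0 < ρ ∧ S a (2 * g + 2) x = I * (((-1) ^ (g - k) * ρ : ℝ) : ℂ) := by
  obtain ⟨ρ, h, e⟩ := S_int hmono (i := 2 * k) (by omega) hx
  refine ⟨ρ, h, ?_⟩
  rw [e, show 2 * g + 2 - (2 * k + 1) = 2 * (g - k) + 1 by omega, pow_succ, pow_mul, I_sq]
  push_cast; ring

lemma eval_conj (p : Polynomial ℂ) (x : ℝ) :
    (p.map (starRingEnd ℂ)).eval (x : ℂ) = (starRingEnd ℂ) (p.eval (x : ℂ)) := by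
  have h := Polynomial.eval_map_apply (p := p) (f := starRingEnd ℂ) (x : ℂ)
  rw [Complex.conj_ofReal] at h
  exact h

lemma W_conj_gap {a : ℕ → ℝ} {g : ℕ} (hmono : ∀ i j, i < j → j < 2 * g + 2 → a i < a j) (p : Polynomial ℂ)
    {k : ℕ} (hk : k < g) :
    (∫ x in a (2 * k + 1)..a (2 * k + 2), W a (2 * g + 2) (p.map (starRingEnd ℂ)) x) =
      (starRingEnd ℂ) (∫ x in a (2 * k + 1)..a (2 * k + 2), W a (2 * g + 2) p x) := by
  rw [← intervalIntegral.intervalIntegral_conj]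
  refine intervalIntegral.integral_congr_Ioo_of_le (hmono _ _ (by omega) (by omega)).le fun x hx => ?_
  obtain ⟨ρ, h, e⟩ := S_gap hmono hk hx
  simp only [W, e, map_div₀, Complex.conj_ofReal, eval_conj]

lemma W_conj_arc {a : ℕ → ℝ} {g : ℕ} (hmono : ∀ i j, i < j → j < 2 * g + 2 → a i < a j) (p : Polynomial ℂ)
    {k : ℕ} (hk : k ≤ g) :
    (∫ x in a (2 * k)..a (2 * k + 1), W a (2 * g + 2) (p.map (starRingEnd ℂ)) x) =
      - (starRingEnd ℂ) (∫ x in a (2 * k)..a (2 * k + 1), W a (2 * g + 2) p x) := by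
  rw [← intervalIntegral.intervalIntegral_conj, ← intervalIntegral.integral_neg]
  refine intervalIntegral.integral_congr_Ioo_of_le (hmono _ _ (by omega) (by omega)).le fun x hx => ?_
  obtain ⟨ρ, h, e⟩ := S_arc hmono hk hx
  simp only [W, e, map_div₀, Complex.conj_ofReal, eval_conj, map_mul, conj_I]
  rw [neg_mul, div_neg, neg_neg]

lemma sum_split (f : ℕ → ℂ) (m : ℕ) : ∑ i ∈ Finset.range (2 * m + 1), f i =
    ∑ t ∈ Finset.range (m + 1), f (2 * t) + ∑ k ∈ Finset.range m, f (2 * k + 1) := by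
  induction m with
  | zero => simp
  | succ m ih =>
    rw [show 2 * (m + 1) + 1 = (2 * m + 1) + 1 + 1 by ring, Finset.sum_range_succ, Finset.sum_range_succ, ih,
      Finset.sum_range_succ (fun t => f (2 * t)) (m + 1), Finset.sum_range_succ (fun k => f (2 * k + 1)) m]
    rw [show 2 * m + 1 + 1 = 2 * (m + 1) by ring]
    ring

lemma total_split {a : ℕ → ℝ} {g : ℕ} (hmono : ∀ i j, i < j → j < 2 * g + 2 → a i < a j) (p : Polynomial ℂ) :
    (∫ x in a 0..a (2 * g + 1), W a (2 * g + 2) p x) =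
      ∑ t ∈ Finset.range (g + 1), (∫ x in a (2 * t)..a (2 * t + 1), W a (2 * g + 2) p x) +
      ∑ k ∈ Finset.range g, (∫ x in a (2 * k + 1)..a (2 * k + 2), W a (2 * g + 2) p x) := by
  rw [← intervalIntegral.sum_integral_adjacent_intervals (fun k _ => W_integrable hmono p _ _)]
  rw [sum_split]

/-- the sum over the gaps vanishes -/
lemma gaps_zero {a : ℕ → ℝ} {g : ℕ} (hmono : ∀ i j, i < j → j < 2 * g + 2 → a i < a j) (p : Polynomial ℂ)
    (h1 : (∫ x in a 0..a (2 * g + 1), W a (2 * g + 2) p x) = 0)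
    (h2 : (∫ x in a 0..a (2 * g + 1), W a (2 * g + 2) (p.map (starRingEnd ℂ)) x) = 0) :
    ∑ k ∈ Finset.range g, (∫ x in a (2 * k + 1)..a (2 * k + 2), W a (2 * g + 2) p x) = 0 := by
  rw [total_split hmono] at h1 h2
  rw [Finset.sum_congr rfl (fun t ht => W_conj_arc hmono p (Nat.lt_succ_iff.1 (Finset.mem_range.1 ht))),
    Finset.sum_congr rfl (fun t ht => W_conj_gap hmono p (Finset.mem_range.1 ht)),
    Finset.sum_neg_distrib, ← map_sum, ← map_sum, ← map_neg, ← map_add,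
    map_eq_zero] at h2
  linear_combination (h1 + h2) / 2

lemma exists_zero {h k : ℝ → ℝ} {u v : ℝ} (huv : u < v) (hc : Continuous h) (hk : ∀ x ∈ Ioo u v, 0 < k x)
    (hi : IntervalIntegrable (fun x => h x * k x) MeasureTheory.volume u v)
    (h0 : ∫ x in u..v, h x * k x = 0) : ∃ x ∈ Ioo u v, h x = 0 := by
  by_contra hcon
  push Not at hcon
  have hdich : (∀ x ∈ Ioo u v, 0 < h x) ∨ (∀ x ∈ Ioo u v, h x < 0) := by
    by_contra hd
    push Not at hd
    obtain ⟨⟨x, hx, hx'⟩, y, hy, hy'⟩ := hd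
    obtain ⟨w, hw, hw0⟩ := isPreconnected_Ioo.intermediate_value hx hy hc.continuousOn
      (show (0:ℝ) ∈ Icc (h x) (h y) from ⟨hx', hy'⟩)
    exact hcon w hw hw0
  rcases hdich with hd | hd
  · have := intervalIntegral.intervalIntegral_pos_of_pos_on hi (fun x hx => mul_pos (hd x hx) (hk x hx)) huv
    linarith
  · have := intervalIntegral.intervalIntegral_pos_of_pos_on hi.neg
      (fun x hx => neg_pos.2 (mul_neg_of_neg_of_pos (hd x hx) (hk x hx))) huv
    simp only [Pi.neg_apply, intervalIntegral.integral_neg] at this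
    linarith

/-- real linear functional `φ` applied to `p` vanishes somewhere in a gap -/
lemma gap_zero {a : ℕ → ℝ} {g : ℕ} (hmono : ∀ i j, i < j → j < 2 * g + 2 → a i < a j) (p : Polynomial ℂ)
    (φ : ℂ →L[ℝ] ℝ) {k : ℕ} (hk : k < g)
    (h0 : φ (∫ x in a (2 * k + 1)..a (2 * k + 2), W a (2 * g + 2) p x) = 0) :
    ∃ x ∈ Ioo (a (2 * k + 1)) (a (2 * k + 2)), φ (p.eval (x : ℂ)) = 0 := by
  have hlt : a (2 * k + 1) < a (2 * k + 2) := hmono _ _ (by omega) (by omega)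
  have hI := W_integrable hmono p (a (2 * k + 1)) (a (2 * k + 2))
  rw [← φ.intervalIntegral_comp_comm hI] at h0
  have hφI : IntervalIntegrable (fun x : ℝ => φ (W a (2 * g + 2) p x)) MeasureTheory.volume
      (a (2 * k + 1)) (a (2 * k + 2)) := ⟨φ.integrable_comp hI.1, φ.integrable_comp hI.2⟩
  have he : ∀ x ∈ Ioo (a (2 * k + 1)) (a (2 * k + 2)),
      φ (p.eval (x : ℂ)) * ((-1) ^ (g - k) * (S a (2 * g + 2) x)⁻¹.re)
        = (-1) ^ (g - k) * φ (W a (2 * g + 2) p x) ∧ 0 < (-1) ^ (g - k) * (S a (2 * g + 2) x)⁻¹.re := by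
    intro x hx
    obtain ⟨ρ, h, e⟩ := S_gap hmono hk hx
    have e2 : W a (2 * g + 2) p x = ((((-1) ^ (g - k) * ρ : ℝ)⁻¹ : ℝ) : ℝ) • p.eval (x : ℂ) := by
      unfold W; rw [e, Complex.real_smul, div_eq_inv_mul, ofReal_inv]
    rw [e2, φ.map_smul, e, ← ofReal_inv, ofReal_re, smul_eq_mul]
    constructor
    · ring
    · rw [mul_inv, ← mul_assoc, mul_inv_cancel₀ (by positivity), one_mul]; positivity
  refine exists_zero hlt (φ.continuous.comp (p.continuous.comp continuous_ofReal)) (fun x hx => (he x hx).2) ?_ ?_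
  · refine (hφI.const_mul ((-1) ^ (g - k))).congr_uIoo ?_
    rw [uIoo_of_le hlt.le]
    exact fun x hx => ((he x hx).1).symm
  · rw [intervalIntegral.integral_congr_Ioo_of_le hlt.le (fun x hx => (he x hx).1),
      intervalIntegral.integral_const_mul, h0, mul_zero]

lemma real_poly {a : ℕ → ℝ} {g : ℕ} (hg : 2 ≤ g) (hmono : ∀ i j, i < j → j < 2 * g + 2 → a i < a j)
    (p : Polynomial ℂ) (hdeg : p.natDegree ≤ g - 1)
    (hgap : ∀ k, k + 1 ≤ g - 1 →
      (∫ x in a (2 * k + 1)..a (2 * k + 2), W a (2 * g + 2) p x) = if k = 0 then 1 / 2 else 0)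
    (h1 : (∫ x in a 0..a (2 * g + 1), W a (2 * g + 2) p x) = 0)
    (h2 : (∫ x in a 0..a (2 * g + 1), W a (2 * g + 2) (p.map (starRingEnd ℂ)) x) = 0) :
    p.map (starRingEnd ℂ) = p := by
  have hz := gaps_zero hmono p h1 h2
  have him : ∀ k < g, (∫ x in a (2 * k + 1)..a (2 * k + 2), W a (2 * g + 2) p x).im = 0 := by
    have him1 : ∀ k < g - 1, (∫ x in a (2 * k + 1)..a (2 * k + 2), W a (2 * g + 2) p x).im = 0 := by
      intro k hk
      rw [hgap k (by omega)]
      split_ifs <;> simp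
    intro k hk
    by_cases hk1 : k < g - 1
    · exact him1 k hk1
    · obtain rfl : k = g - 1 := by omega
      have hh := congrArg Complex.im hz
      obtain ⟨m, rfl⟩ : ∃ m, g = m + 1 := ⟨g - 1, by omega⟩
      rw [Finset.sum_range_succ, add_im, im_sum, Finset.sum_eq_zero (fun k hk => him1 k (by simpa using hk)),
        zero_add] at hh
      simpa using hh
  have hex : ∀ k : Fin g, ∃ x ∈ Ioo (a (2 * k + 1)) (a (2 * k + 2)), (p.eval (x : ℂ)).im = 0 :=
    fun k => gap_zero hmono p Complex.imCLM k.2 (him k k.2)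
  choose y hy hy0 using hex
  have hinj : StrictMono y := by
    intro i j hij
    have hij' : (i : ℕ) < j := hij
    have := j.2
    have h3 : a (2 * i + 2) < a (2 * j + 1) := hmono _ _ (by omega) (by omega)
    exact ((hy i).2.trans h3).trans (hy j).1
  have hD : p.map (starRingEnd ℂ) - p = 0 := by
    refine Polynomial.eq_zero_of_natDegree_lt_card_of_eval_eq_zero (f := fun k : Fin g => (y k : ℂ)) _
      (fun i j h => hinj.injective (by simpa using h)) ?_ ?_
    · intro k
      rw [Polynomial.eval_sub, eval_conj, sub_eq_zero, Complex.conj_eq_iff_im]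
      exact hy0 k
    · rw [Fintype.card_fin]
      have := Polynomial.natDegree_sub_le (p.map (starRingEnd ℂ)) p
      have h4 : (p.map (starRingEnd ℂ)).natDegree ≤ p.natDegree := Polynomial.natDegree_map_le
      rcases le_max_iff.1 this with h | h <;> omega
  exact sub_eq_zero.1 hD

lemma factor {a : ℕ → ℝ} {g : ℕ} (hg : 2 ≤ g) (hmono : ∀ i j, i < j → j < 2 * g + 2 → a i < a j)
    (p : Polynomial ℂ) (hdeg : p.natDegree ≤ g - 1)
    (hgap : ∀ k, k + 1 ≤ g - 1 →
      (∫ x in a (2 * k + 1)..a (2 * k + 2), W a (2 * g + 2) p x) = if k = 0 then 1 / 2 else 0)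
    (hreal : p.map (starRingEnd ℂ) = p) :
    ∃ (b : ℕ → ℝ) (α β : ℝ), (∀ k < g - 2, b k ∈ Ioo (a (2 * k + 3)) (a (2 * k + 4))) ∧
      ∀ z : ℂ, p.eval z = (∏ k ∈ Finset.range (g - 2), (z - b k)) * (α * z + β) := by
  obtain ⟨pr, rfl⟩ : ∃ pr : Polynomial ℝ, pr.map (algebraMap ℝ ℂ) = p := by
    rw [← Polynomial.mem_lifts, Polynomial.lifts_iff_coeff_lifts]
    intro m
    have := congrArg (fun q => Polynomial.coeff q m) hreal
    simp only [Polynomial.coeff_map] at this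
    obtain ⟨r, hr⟩ := Complex.conj_eq_iff_real.1 this
    exact ⟨r, hr.symm⟩
  have hex : ∀ k, ∃ x : ℝ, k < g - 2 → x ∈ Ioo (a (2 * k + 3)) (a (2 * k + 4)) ∧ pr.eval x = 0 := by
    intro k
    by_cases hk : k < g - 2
    · obtain ⟨x, hx, hx0⟩ := gap_zero hmono (pr.map (algebraMap ℝ ℂ)) Complex.reCLM (k := k + 1) (by omega)
        (by rw [hgap (k + 1) (by omega)]; simp)
      refine ⟨x, fun _ => ⟨hx, ?_⟩⟩
      have := Polynomial.eval_map_apply (p := pr) (f := algebraMap ℝ ℂ) x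
      rw [Complex.coe_algebraMap] at this
      rw [this] at hx0
      simpa using hx0
    · exact ⟨0, fun h => absurd h hk⟩
  choose b hb using hex
  have hdvd : ∏ k ∈ Finset.range (g - 2), (Polynomial.X - Polynomial.C (b k)) ∣ pr := by
    refine Finset.prod_dvd_of_coprime ?_ ?_
    · intro i hi j hj hij
      have hi : i < g - 2 := by simpa using hi
      have hj : j < g - 2 := by simpa using hj
      refine Polynomial.isCoprime_X_sub_C_of_isUnit_sub ?_
      refine (sub_ne_zero.2 ?_).isUnit
      rcases lt_or_gt_of_ne hij with h | h
      · have h3 : a (2 * i + 4) < a (2 * j + 3) := hmono _ _ (by omega) (by omega)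
        exact ((((hb i hi).1.2.trans h3).trans (hb j hj).1.1)).ne
      · have h3 : a (2 * j + 4) < a (2 * i + 3) := hmono _ _ (by omega) (by omega)
        exact ((((hb j hj).1.2.trans h3).trans (hb i hi).1.1)).ne'
    · intro i hi
      rw [Polynomial.dvd_iff_isRoot]
      exact (hb i (by simpa using hi)).2
  obtain ⟨L, hL⟩ := hdvd
  have hLdeg : L.natDegree ≤ 1 := by
    by_cases hL0 : L = 0
    · simp [hL0]
    have hmon : (∏ k ∈ Finset.range (g - 2), (Polynomial.X - Polynomial.C (b k))).Monic :=
      Polynomial.monic_prod_of_monic _ _ fun k _ => Polynomial.monic_X_sub_C _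
    rw [hL, Polynomial.natDegree_map, hmon.natDegree_mul' hL0,
      Polynomial.natDegree_prod_of_monic _ _ (fun k _ => Polynomial.monic_X_sub_C _)] at hdeg
    simp at hdeg
    omega
  refine ⟨b, L.coeff 1, L.coeff 0, fun k hk => (hb k hk).1, fun z => ?_⟩
  rw [hL, Polynomial.eq_X_add_C_of_natDegree_le_one hLdeg]
  simp [Polynomial.map_prod, Polynomial.eval_prod]

lemma omega_bound (a : ℕ → ℝ) {g : ℕ} (hg : 2 ≤ g) (p : Polynomial ℂ) (hdeg : p.natDegree ≤ g - 1) :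
    ∃ C r₀ : ℝ, 0 ≤ C ∧ 1 ≤ r₀ ∧ (∀ j < 2 * g + 2, |a j| < r₀) ∧ ∀ z T : ℂ, r₀ ≤ ‖z‖ →
      T ^ 2 = ∏ j ∈ Finset.range (2 * g + 2), (z - (a j : ℂ)) → ‖p.eval z / T‖ ≤ C / ‖z‖ ^ 2 := by
  set C₁ : ℝ := ∑ i ∈ Finset.range g, ‖p.coeff i‖ with hC₁
  have hC₁0 : 0 ≤ C₁ := Finset.sum_nonneg fun _ _ => norm_nonneg _
  set r₀ : ℝ := 1 + 2 * ∑ j ∈ Finset.range (2 * g + 2), |a j| with hr₀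
  have hs : 0 ≤ ∑ j ∈ Finset.range (2 * g + 2), |a j| := Finset.sum_nonneg fun _ _ => abs_nonneg _
  have hle : ∀ j < 2 * g + 2, |a j| ≤ ∑ j ∈ Finset.range (2 * g + 2), |a j| := fun j hj =>
    Finset.single_le_sum (f := fun j => |a j|) (fun _ _ => abs_nonneg _) (Finset.mem_range.2 hj)
  refine ⟨C₁ * 2 ^ (g + 1), r₀, by positivity, by linarith, fun j hj => by linarith [hle j hj], ?_⟩
  intro z T hz hT
  have hz1 : 1 ≤ ‖z‖ := by linarith
  have hz0 : 0 < ‖z‖ := by linarith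
  have hp : ‖p.eval z‖ ≤ C₁ * ‖z‖ ^ (g - 1) := by
    rw [Polynomial.eval_eq_sum_range' (n := g) (by omega), hC₁, Finset.sum_mul]
    refine norm_sum_le_of_le _ fun i hi => ?_
    rw [norm_mul, norm_pow]
    have := Finset.mem_range.1 hi
    exact mul_le_mul_of_nonneg_left (pow_le_pow_right₀ hz1 (by omega)) (norm_nonneg _)
  have hTn : (‖z‖ / 2) ^ (g + 1) ≤ ‖T‖ := by
    refine le_of_sq_le_sq ?_ (norm_nonneg _)
    rw [← norm_pow, hT, norm_prod, ← pow_mul, show (g + 1) * 2 = 2 * g + 2 by ring]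
    have : (‖z‖ / 2) ^ (2 * g + 2) = ∏ j ∈ Finset.range (2 * g + 2), (‖z‖ / 2) := by
      rw [Finset.prod_const, Finset.card_range]
    rw [this]
    refine Finset.prod_le_prod (fun _ _ => by positivity) fun j hj => ?_
    have h1 := norm_sub_norm_le z (a j : ℂ)
    rw [Complex.norm_real, Real.norm_eq_abs] at h1
    have := hle j (Finset.mem_range.1 hj)
    linarith
  rw [norm_div]
  calc ‖p.eval z‖ / ‖T‖ ≤ C₁ * ‖z‖ ^ (g - 1) / (‖z‖ / 2) ^ (g + 1) := by
        gcongr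
    _ = C₁ * 2 ^ (g + 1) / ‖z‖ ^ 2 := by
        rw [div_pow, show g + 1 = (g - 1) + 2 by omega, pow_add ‖z‖]
        field_simp

lemma far {F f : ℂ → ℂ} {C r₀ : ℝ} (hC : 0 ≤ C) (hr₀ : 1 ≤ r₀)
    (hF : ∀ z : ℂ, r₀ ≤ ‖z‖ → HasDerivAt F (-2 * f z) z)
    (hf : ∀ z : ℂ, r₀ ≤ ‖z‖ → ‖f z‖ ≤ C / ‖z‖ ^ 2) :
    Tendsto (fun r : ℝ => F (r : ℂ) - F ((-r : ℝ) : ℂ)) atTop (nhds 0) := by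
  have key : ∀ r : ℝ, r₀ ≤ r → ‖F (r : ℂ) - F ((-r : ℝ) : ℂ)‖ ≤ 8 * C / r := by
    intro r hr
    have hr0 : 0 < r := by linarith
    have hseg : ∀ s : Set ℂ, Convex ℝ s → (∀ z ∈ s, r ≤ ‖z‖) → ∀ u ∈ s, ∀ v ∈ s,
        ‖F v - F u‖ ≤ 2 * C / r ^ 2 * ‖v - u‖ := by
      intro s hs hsr u hu v hv
      refine hs.norm_image_sub_le_of_norm_hasDerivWithin_le (f' := fun z => -2 * f z)
        (fun z hz => (hF z (hr.trans (hsr z hz))).hasDerivWithinAt) (fun z hz => ?_) hu hv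
      have h1 := hf z (hr.trans (hsr z hz))
      have h2 : C / ‖z‖ ^ 2 ≤ C / r ^ 2 := by
        have := hsr z hz
        gcongr
      rw [norm_mul]
      have : ‖(-2 : ℂ)‖ = 2 := by simp
      rw [this, mul_div_assoc]
      linarith
    have b1 := hseg {z | r ≤ z.re} (convex_halfSpace_re_ge r)
      (fun z hz => le_trans hz (Complex.re_le_norm z)) (r + r * I : ℂ) (by simp) (r : ℂ) (by simp)
    have b2 := hseg {z | r ≤ z.im} (convex_halfSpace_im_ge r)
      (fun z hz => le_trans hz (Complex.im_le_norm z)) (-r + r * I : ℂ) (by simp) (r + r * I : ℂ) (by simp)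
    have b3 := hseg {z | z.re ≤ -r} (convex_halfSpace_re_le (-r))
      (fun z hz => by
        have h1 := Complex.abs_re_le_norm z
        have h2 : z.re ≤ -r := hz
        have := neg_le_abs z.re
        linarith) ((-r : ℝ) : ℂ) (by simp) (-r + r * I : ℂ) (by simp)
    have n1 : ‖(r : ℂ) - (r + r * I)‖ = r := by
      rw [show (r : ℂ) - (r + r * I) = -(r * I) by ring]; simp [abs_of_pos hr0]
    have n2 : ‖(r + r * I : ℂ) - (-r + r * I)‖ = 2 * r := by
      rw [show (r + r * I : ℂ) - (-r + r * I) = 2 * r by ring]; simp [abs_of_pos hr0]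
    have n3 : ‖(-r + r * I : ℂ) - ((-r : ℝ) : ℂ)‖ = r := by
      rw [show (-r + r * I : ℂ) - ((-r : ℝ) : ℂ) = r * I by push_cast; ring]; simp [abs_of_pos hr0]
    rw [n1] at b1; rw [n2] at b2; rw [n3] at b3
    have e : F (r : ℂ) - F ((-r : ℝ) : ℂ) = (F r - F (r + r * I)) + (F (r + r * I) - F (-r + r * I))
        + (F (-r + r * I) - F ((-r : ℝ) : ℂ)) := by ring
    rw [e]
    refine (norm_add₃_le).trans ?_
    have : 8 * C / r = 2 * C / r ^ 2 * r + 2 * C / r ^ 2 * (2 * r) + 2 * C / r ^ 2 * r := by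
      field_simp; ring
    rw [this]
    linarith
  refine squeeze_zero_norm' ?_ (tendsto_const_nhds (x := 8 * C).div_atTop tendsto_id)
  filter_upwards [eventually_ge_atTop r₀] with r hr using key r hr

lemma neg_one_pow_sq (m : ℕ) : ((-1 : ℝ) ^ m) * (-1) ^ m = 1 := by
  rw [← mul_pow]; simp

lemma W_right {a b : ℕ → ℝ} {g : ℕ} (hmono : ∀ i j, i < j → j < 2 * g + 2 → a i < a j)
    {p : Polynomial ℂ} {α β : ℝ}
    (hb : ∀ k < g - 2, b k ∈ Ioo (a (2 * k + 3)) (a (2 * k + 4)))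
    (hp : ∀ z : ℂ, p.eval z = (∏ k ∈ Finset.range (g - 2), (z - b k)) * (α * z + β))
    {x : ℝ} (hx : a (2 * g + 1) < x) :
    ∃ c : ℝ, 0 < c ∧ W a (2 * g + 2) p x = ((c * (α * x + β) : ℝ) : ℂ) := by
  have hax : ∀ j < 2 * g + 2, a j < x := fun j hj => by
    rcases (show j ≤ 2 * g + 1 by omega).lt_or_eq with h | h
    · exact (hmono _ _ h (by omega)).trans hx
    · rw [h]; exact hx
  obtain ⟨ρ, hρ, eS⟩ := S_real (a := a) (n := 2 * g + 2) (m := 2 * g + 2) le_rfl hax (fun j h1 h2 => by omega)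
  obtain ⟨q, hq, eQ⟩ := prod_sign (b := b) (n := g - 2) (m := g - 2) (x := x) le_rfl
    (fun j hj => (hb j hj).2.trans (hax _ (by omega))) (fun j h1 h2 => by omega)
  have eQ' := congrArg (fun r : ℝ => (r : ℂ)) eQ
  simp only [ofReal_prod, ofReal_sub] at eQ'
  refine ⟨q / ρ, by positivity, ?_⟩
  unfold W
  rw [hp, eS, eQ']
  simp only [Nat.sub_self, pow_zero]
  push_cast
  ring

lemma W_left {a b : ℕ → ℝ} {g : ℕ} (hg : 2 ≤ g) (hmono : ∀ i j, i < j → j < 2 * g + 2 → a i < a j)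
    {p : Polynomial ℂ} {α β : ℝ}
    (hb : ∀ k < g - 2, b k ∈ Ioo (a (2 * k + 3)) (a (2 * k + 4)))
    (hp : ∀ z : ℂ, p.eval z = (∏ k ∈ Finset.range (g - 2), (z - b k)) * (α * z + β))
    {x : ℝ} (hx : x < a 0) :
    ∃ c : ℝ, 0 < c ∧ W a (2 * g + 2) p x = ((-(c * (α * x + β)) : ℝ) : ℂ) := by
  have hax : ∀ j < 2 * g + 2, x < a j := fun j hj => by
    rcases (Nat.zero_le j).lt_or_eq with h | h
    · exact hx.trans (hmono _ _ h (by omega))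
    · rw [← h]; exact hx
  obtain ⟨ρ, hρ, eS⟩ := S_real (a := a) (n := 2 * g + 2) (m := 0) (Nat.zero_le _) (fun j h => by omega)
    (fun j _ h => hax j h)
  obtain ⟨q, hq, eQ⟩ := prod_sign (b := b) (n := g - 2) (m := 0) (x := x) (Nat.zero_le _)
    (fun j h => by omega) (fun j _ hj => (hax _ (by omega)).trans (hb j hj).1)
  have eQ' := congrArg (fun r : ℝ => (r : ℂ)) eQ
  simp only [ofReal_prod, ofReal_sub] at eQ'
  refine ⟨q / ρ, by positivity, ?_⟩
  unfold W
  obtain ⟨h, rfl⟩ : ∃ h, g = h + 2 := ⟨g - 2, by omega⟩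
  rw [hp, eS, eQ']
  rw [show 2 * (h + 2) + 2 - 0 = 2 * (h + 3) by omega, pow_mul, I_sq,
    show h + 2 - 2 - 0 = h by omega]
  have h1 : ((-1 : ℂ) ^ h) ≠ 0 := by simp
  have hρ' : (ρ : ℂ) ≠ 0 := by exact_mod_cast hρ.ne'
  push_cast
  rw [pow_add]
  field_simp

lemma W_gap0 {a b : ℕ → ℝ} {g : ℕ} (hg : 2 ≤ g) (hmono : ∀ i j, i < j → j < 2 * g + 2 → a i < a j)
    {p : Polynomial ℂ} {α β : ℝ}
    (hb : ∀ k < g - 2, b k ∈ Ioo (a (2 * k + 3)) (a (2 * k + 4)))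
    (hp : ∀ z : ℂ, p.eval z = (∏ k ∈ Finset.range (g - 2), (z - b k)) * (α * z + β))
    {x : ℝ} (hx : x ∈ Ioo (a 1) (a 2)) :
    ∃ c : ℝ, 0 < c ∧ W a (2 * g + 2) p x = ((c * (α * x + β) : ℝ) : ℂ) := by
  obtain ⟨ρ, hρ, eS⟩ := S_gap hmono (k := 0) (by omega) hx
  obtain ⟨q, hq, eQ⟩ := prod_sign (b := b) (n := g - 2) (m := 0) (x := x) (Nat.zero_le _)
    (fun j h => by omega)
    (fun j _ hj => (hx.2.trans (hmono 2 (2 * j + 3) (by omega) (by omega))).trans (hb j hj).1)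
  have eQ' := congrArg (fun r : ℝ => (r : ℂ)) eQ
  simp only [ofReal_prod, ofReal_sub] at eQ'
  refine ⟨q / ρ, by positivity, ?_⟩
  unfold W
  obtain ⟨h, rfl⟩ : ∃ h, g = h + 2 := ⟨g - 2, by omega⟩
  rw [hp, eS, eQ']
  rw [show h + 2 - 2 - 0 = h by omega, show h + 2 - 0 = h + 2 by omega]
  have h1 : ((-1 : ℂ) ^ h) ≠ 0 := by simp
  have hρ' : (ρ : ℂ) ≠ 0 := by exact_mod_cast hρ.ne'
  push_cast
  rw [pow_add]
  field_simp

lemma W_arc {a b : ℕ → ℝ} {g : ℕ} (hg : 2 ≤ g) (hmono : ∀ i j, i < j → j < 2 * g + 2 → a i < a j)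
    {p : Polynomial ℂ} {α β : ℝ}
    (hb : ∀ k < g - 2, b k ∈ Ioo (a (2 * k + 3)) (a (2 * k + 4)))
    (hp : ∀ z : ℂ, p.eval z = (∏ k ∈ Finset.range (g - 2), (z - b k)) * (α * z + β))
    {t : ℕ} (ht : t ≤ g) {x : ℝ} (hx : x ∈ Ioo (a (2 * t)) (a (2 * t + 1))) :
    ∃ c : ℝ, 0 < c ∧ W a (2 * g + 2) p x =
      I * (((if t = 0 ∨ t = g then -1 else 1) * (c * (α * x + β)) : ℝ) : ℂ) := by
  obtain ⟨ρ, hρ, eS⟩ := S_arc hmono ht hx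
  obtain ⟨m, hm, hmm⟩ : ∃ m, m = min (t - 1) (g - 2) ∧ m ≤ g - 2 := ⟨_, rfl, min_le_right _ _⟩
  obtain ⟨q, hq, eQ⟩ := prod_sign (b := b) (n := g - 2) (m := m) (x := x) hmm
    (fun j h => by
      refine ((hb j (by omega)).2.trans_le ?_).trans hx.1
      rcases (show 2 * j + 4 ≤ 2 * t by omega).lt_or_eq with h | h
      · exact (hmono _ _ h (by omega)).le
      · rw [h])
    (fun j h hj => by
      refine hx.2.trans (lt_of_le_of_lt ?_ (hb j hj).1)
      rcases (show 2 * t + 1 ≤ 2 * j + 3 by omega).lt_or_eq with h | h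
      · exact (hmono _ _ h (by omega)).le
      · rw [h])
  have eQ' := congrArg (fun r : ℝ => (r : ℂ)) eQ
  simp only [ofReal_prod, ofReal_sub] at eQ'
  refine ⟨q / ρ, by positivity, ?_⟩
  have hsgn : ((-1 : ℝ) ^ (g - 2 - m)) = - (if t = 0 ∨ t = g then -1 else 1) * (-1) ^ (g - t) := by
    rcases Nat.eq_zero_or_pos t with h0 | h0
    · subst h0
      obtain ⟨h, rfl⟩ : ∃ h, g = h + 2 := ⟨g - 2, by omega⟩
      obtain rfl : m = 0 := by omega
      simp [pow_add]
    · rcases ht.lt_or_eq with h1 | h1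
      · rw [if_neg (by omega), show g - t = (g - 2 - m) + 1 by omega, pow_succ]; ring
      · rw [if_pos (Or.inr h1), show g - 2 - m = 0 by omega, show g - t = 0 by omega]; simp
  rw [hsgn] at eQ'
  set s : ℝ := if t = 0 ∨ t = g then -1 else 1
  unfold W
  rw [hp, eS, eQ']
  have h1 : ((-1 : ℂ) ^ (g - t)) ≠ 0 := by simp
  have hρ' : (ρ : ℂ) ≠ 0 := by exact_mod_cast hρ.ne'
  push_cast
  field_simp
  rw [I_sq]
  ring

lemma L_pos {a b : ℕ → ℝ} {g : ℕ} (hg : 2 ≤ g) (hmono : ∀ i j, i < j → j < 2 * g + 2 → a i < a j)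
    {p : Polynomial ℂ} {α β : ℝ}
    (hb : ∀ k < g - 2, b k ∈ Ioo (a (2 * k + 3)) (a (2 * k + 4)))
    (hp : ∀ z : ℂ, p.eval z = (∏ k ∈ Finset.range (g - 2), (z - b k)) * (α * z + β))
    (hgap0 : (∫ x in a 1..a 2, W a (2 * g + 2) p x) = 1 / 2)
    (htot : (∫ x in a 0..a (2 * g + 1), W a (2 * g + 2) p x) = 0)
    (hlim : Tendsto (fun r : ℝ => ∫ x in (-r)..r, W a (2 * g + 2) p x) atTop (nhds 0)) :
    ∀ x ∈ Icc (a 0) (a (2 * g + 1)), 0 < α * x + β := by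
  have h01 : a 0 < a 1 := hmono _ _ (by omega) (by omega)
  have h12 : a 1 < a 2 := hmono _ _ (by omega) (by omega)
  have h2l : a 2 < a (2 * g + 1) := hmono _ _ (by omega) (by omega)
  have hI := W_integrable hmono p
  have hroot : ∀ x ∈ Icc (a 0) (a (2 * g + 1)), α * x + β ≠ 0 := by
    intro b₀ hb₀ h0
    have hα : α ≠ 0 := by
      rintro rfl
      have hβ : β = 0 := by linarith
      have hz : (∫ x in a 1..a 2, W a (2 * g + 2) p x) = ∫ x in a 1..a 2, 0 := by
        refine intervalIntegral.integral_congr fun x _ => ?_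
        simp [W, hp, hβ]
      rw [hz] at hgap0
      simp at hgap0
    have hL : ∀ x : ℝ, α * x + β = α * (x - b₀) := fun x => by linarith
    have hpr : ∀ x : ℝ, a (2 * g + 1) < x → 0 < α * (W a (2 * g + 2) p x).re := by
      intro x hx
      obtain ⟨c, hc, e⟩ := W_right hmono hb hp hx
      rw [e, ofReal_re, hL]
      have : 0 < x - b₀ := by linarith [hb₀.2]
      have := mul_pos (mul_pos hc this) (mul_self_pos.2 hα)
      nlinarith
    have hpl : ∀ x : ℝ, x < a 0 → 0 < α * (W a (2 * g + 2) p x).re := by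
      intro x hx
      obtain ⟨c, hc, e⟩ := W_left hg hmono hb hp hx
      rw [e, ofReal_re, hL]
      have : 0 < b₀ - x := by linarith [hb₀.1]
      have := mul_pos (mul_pos hc this) (mul_self_pos.2 hα)
      nlinarith
    have hR : ∀ u v, a (2 * g + 1) ≤ u → u < v → 0 < α * (∫ x in u..v, W a (2 * g + 2) p x).re := by
      intro u v hu huv
      rw [re_integral hmono, ← intervalIntegral.integral_const_mul]
      exact intervalIntegral.intervalIntegral_pos_of_pos_on ((re_integrable hmono p _ _).const_mul _)
        (fun x hx => hpr x (by linarith [hx.1])) huv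
    have hLf : ∀ u v, v ≤ a 0 → u < v → 0 < α * (∫ x in u..v, W a (2 * g + 2) p x).re := by
      intro u v hu huv
      rw [re_integral hmono, ← intervalIntegral.integral_const_mul]
      exact intervalIntegral.intervalIntegral_pos_of_pos_on ((re_integrable hmono p _ _).const_mul _)
        (fun x hx => hpl x (by linarith [hx.2])) huv
    set r₁ := |a 0| + |a (2 * g + 1)| + 1 with hr₁
    have hr1 : a (2 * g + 1) < r₁ := by
      have := le_abs_self (a (2 * g + 1)); have := abs_nonneg (a 0); linarith
    have hr2 : -r₁ < a 0 := by
      have := neg_abs_le (a 0); have := abs_nonneg (a (2 * g + 1)); linarith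
    have hk : 0 < α * (∫ x in a (2 * g + 1)..r₁, W a (2 * g + 2) p x).re := hR _ _ le_rfl hr1
    have hlow : ∀ r, r₁ < r → α * (∫ x in a (2 * g + 1)..r₁, W a (2 * g + 2) p x).re ≤
        α * (∫ x in (-r)..r, W a (2 * g + 2) p x).re := by
      intro r hr
      rw [← intervalIntegral.integral_add_adjacent_intervals (hI (-r) (a 0)) (hI (a 0) r),
        ← intervalIntegral.integral_add_adjacent_intervals (hI (a 0) (a (2 * g + 1))) (hI (a (2 * g + 1)) r),
        ← intervalIntegral.integral_add_adjacent_intervals (hI (a (2 * g + 1)) r₁) (hI r₁ r), htot]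
      have e1 := hLf (-r) (a 0) le_rfl (by linarith)
      have e2 := hR r₁ r hr1.le hr
      simp only [add_re, zero_re]
      linarith
    have hlim2 : Tendsto (fun r : ℝ => α * (∫ x in (-r)..r, W a (2 * g + 2) p x).re) atTop (nhds (α * (0:ℂ).re)) :=
      ((Complex.continuous_re.tendsto _).comp hlim).const_mul α
    have := ge_of_tendsto hlim2 (by
      filter_upwards [eventually_gt_atTop r₁] with r hr using hlow r hr)
    simp at this
    linarith
  intro x hx
  by_contra hcon
  push Not at hcon
  have hneg : ∀ y ∈ Icc (a 0) (a (2 * g + 1)), α * y + β < 0 := by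
    intro y hy
    by_contra hy'
    push Not at hy'
    obtain ⟨w, hw, hw0⟩ := isPreconnected_Icc.intermediate_value hx hy
      (f := fun y => α * y + β) (by fun_prop) (show (0:ℝ) ∈ Icc (α * x + β) (α * y + β) from ⟨hcon, hy'⟩)
    exact hroot w hw hw0
  have hpos : 0 < ∫ x in a 1..a 2, - (W a (2 * g + 2) p x).re := by
    refine intervalIntegral.intervalIntegral_pos_of_pos_on (re_integrable hmono p _ _).neg ?_ h12
    intro y hy
    obtain ⟨c, hc, e⟩ := W_gap0 hg hmono hb hp hy
    rw [e, ofReal_re]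
    have := hneg y ⟨by linarith [hy.1], by linarith [hy.2]⟩
    nlinarith
  rw [intervalIntegral.integral_neg, ← re_integral hmono, hgap0] at hpos
  norm_num at hpos

lemma arc_re_zero {a b : ℕ → ℝ} {g : ℕ} (hg : 2 ≤ g) (hmono : ∀ i j, i < j → j < 2 * g + 2 → a i < a j)
    {p : Polynomial ℂ} {α β : ℝ}
    (hb : ∀ k < g - 2, b k ∈ Ioo (a (2 * k + 3)) (a (2 * k + 4)))
    (hp : ∀ z : ℂ, p.eval z = (∏ k ∈ Finset.range (g - 2), (z - b k)) * (α * z + β))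
    {t : ℕ} (ht : t ≤ g) {u v : ℝ} (hu : a (2 * t) ≤ u) (huv : u ≤ v) (hv : v ≤ a (2 * t + 1)) :
    (∫ x in u..v, W a (2 * g + 2) p x).re = 0 := by
  rw [re_integral hmono]
  have : ∫ x in u..v, (W a (2 * g + 2) p x).re = ∫ x in u..v, (0 : ℝ) := by
    refine intervalIntegral.integral_congr_Ioo_of_le huv fun x hx => ?_
    obtain ⟨c, hc, e⟩ := W_arc hg hmono hb hp ht (x := x) ⟨by linarith [hx.1], by linarith [hx.2]⟩
    simp only [e]
    rw [I_mul_re, ofReal_im, neg_zero]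
  rw [this]; simp

lemma values {a b : ℕ → ℝ} {g : ℕ} (hg : 2 ≤ g) (hmono : ∀ i j, i < j → j < 2 * g + 2 → a i < a j)
    {p : Polynomial ℂ} {α β : ℝ}
    (hb : ∀ k < g - 2, b k ∈ Ioo (a (2 * k + 3)) (a (2 * k + 4)))
    (hp : ∀ z : ℂ, p.eval z = (∏ k ∈ Finset.range (g - 2), (z - b k)) * (α * z + β))
    (hgap : ∀ k, k + 1 ≤ g - 1 →
      (∫ x in a (2 * k + 1)..a (2 * k + 2), W a (2 * g + 2) p x) = if k = 0 then 1 / 2 else 0)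
    (htot : (∫ x in a 0..a (2 * g + 1), W a (2 * g + 2) p x) = 0)
    {t : ℕ} (ht : t ≤ g) {x : ℝ} (hx : x ∈ Icc (a (2 * t)) (a (2 * t + 1))) :
    (∫ y in a 0..x, W a (2 * g + 2) p y).re = if t = 0 ∨ t = g then 0 else 1 / 2 := by
  have hI := W_integrable hmono p
  have hend : ∀ t, t ≤ g - 1 → (∫ y in a 0..a (2 * t), W a (2 * g + 2) p y).re = if t = 0 then 0 else 1 / 2 := by
    intro t
    induction t with
    | zero => intro _; simp
    | succ t ih =>
      intro ht
      rw [← intervalIntegral.integral_add_adjacent_intervals (hI (a 0) (a (2 * t))) (hI (a (2 * t)) (a (2 * (t + 1)))),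
        ← intervalIntegral.integral_add_adjacent_intervals (hI (a (2 * t)) (a (2 * t + 1))) (hI (a (2 * t + 1)) (a (2 * (t + 1))))]
      rw [show 2 * (t + 1) = 2 * t + 2 by ring, hgap t (by omega), add_re, add_re, ih (by omega),
        arc_re_zero hg hmono hb hp (t := t) (by omega) le_rfl (hmono _ _ (by omega) (by omega)).le le_rfl]
      by_cases h : t = 0 <;> simp [h]
  by_cases htg : t = g
  · subst htg
    rw [if_pos (Or.inr rfl)]
    rw [← intervalIntegral.integral_add_adjacent_intervals (hI (a 0) x) (hI x (a (2 * t + 1)))] at htot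
    have := congrArg Complex.re htot
    rw [add_re, arc_re_zero hg hmono hb hp (t := t) le_rfl hx.1 hx.2 le_rfl] at this
    simpa using this
  · rw [← intervalIntegral.integral_add_adjacent_intervals (hI (a 0) (a (2 * t))) (hI (a (2 * t)) x), add_re,
      arc_re_zero hg hmono hb hp (t := t) ht le_rfl hx.1 hx.2, hend t (by omega), add_zero]
    simp [htg]

lemma core {a : ℕ → ℝ} {g : ℕ} (hg : 2 ≤ g) (hmono : ∀ i j, i < j → j < 2 * g + 2 → a i < a j)
    (p : Polynomial ℂ) (hdeg : p.natDegree ≤ g - 1) (F : ℂ → ℂ)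
    (hder : ∀ z : ℂ, 0 < z.im → HasDerivAt F (-2 * W a (2 * g + 2) p z) z)
    (hder' : ∀ z : ℂ, 0 < z.im → HasDerivAt (fun z => (starRingEnd ℂ) (F ((starRingEnd ℂ) z)))
      (-2 * W a (2 * g + 2) (p.map (starRingEnd ℂ)) z) z)
    (hcont : ∀ x : ℝ, (x < a 0 ∨ a (2 * g + 1) < x) → ContinuousAt F x)
    (hlim : Tendsto (fun t : ℝ => F ((a 0 - t : ℝ) : ℂ)) (nhdsWithin 0 (Ioi 0)) (nhds (1 / 2)))
    (hgap : ∀ k, k + 1 ≤ g - 1 →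
      (∫ x in a (2 * k + 1)..a (2 * k + 2), W a (2 * g + 2) p x) = if k = 0 then 1 / 2 else 0)
    (htot : (∫ x in a 0..a (2 * g + 1), W a (2 * g + 2) p x) = 0)
    (hfar : Tendsto (fun r : ℝ => F (r : ℂ) - F ((-r : ℝ) : ℂ)) atTop (nhds 0))
    {t : ℕ} (ht : t ≤ g) {x₀ : ℝ} (hx₀ : x₀ ∈ Icc (a (2 * t)) (a (2 * t + 1))) :
    ∀ᶠ z in nhds (x₀ : ℂ), z ∉ Complex.ofReal '' Icc (a 0) (a (2 * g + 1)) →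
      (if t = 0 ∨ t = g then 1 else -1) * (F z).re < 1 / 2 := by
  have hcont' : ∀ x : ℝ, (x < a 0 ∨ a (2 * g + 1) < x) →
      ContinuousAt (fun z => (starRingEnd ℂ) (F ((starRingEnd ℂ) z))) x := by
    intro x hx
    refine Complex.continuous_conj.continuousAt.comp
          (ContinuousAt.comp (g := F) ?_ Complex.continuous_conj.continuousAt)
    rw [Complex.conj_ofReal]; exact hcont x hx
  have hlim' : Tendsto (fun t : ℝ => (fun z => (starRingEnd ℂ) (F ((starRingEnd ℂ) z))) ((a 0 - t : ℝ) : ℂ))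
      (nhdsWithin 0 (Ioi 0)) (nhds (1 / 2)) := by
    have := (Complex.continuous_conj.tendsto _).comp hlim
    have e : (starRingEnd ℂ) (1 / 2 : ℂ) = 1 / 2 := by simp only [map_div₀, map_one, map_ofNat]
    rw [e] at this
    simpa [Function.comp_def] using this
  obtain ⟨hb1, hb2⟩ := boundary hmono p F (a (2 * g + 1)) hder hcont hlim
  obtain ⟨hb1', hb2'⟩ := boundary hmono (p.map (starRingEnd ℂ)) _ (a (2 * g + 1)) hder' hcont' hlim'
  have hI := W_integrable hmono
  have hprim : ∀ q, Tendsto (fun x => ∫ y in a 0..x, W a (2 * g + 2) q y) (nhdsWithin (a (2 * g + 1)) (Ioi (a (2 * g + 1))))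
      (nhds (∫ y in a 0..a (2 * g + 1), W a (2 * g + 2) q y)) := fun q =>
    ((intervalIntegral.continuous_primitive (fun u v => hI q u v) (a 0)).tendsto _).mono_left nhdsWithin_le_nhds
  have htot' : (∫ x in a 0..a (2 * g + 1), W a (2 * g + 2) (p.map (starRingEnd ℂ)) x) = 0 := by
    have l1 := hprim (p.map (starRingEnd ℂ))
    have l2 := (Complex.continuous_conj.tendsto _).comp (hprim p)
    rw [htot, map_zero] at l2
    refine tendsto_nhds_unique l1 (l2.congr' ?_)
    filter_upwards [self_mem_nhdsWithin] with x hx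
    have e1 := hb2 x (Or.inr hx)
    have e2 := hb2' x (Or.inr hx)
    simp only [Complex.conj_ofReal] at e2
    rw [e1] at e2
    simp only [map_sub, map_mul, map_div₀, map_one, map_ofNat] at e2
    simp only [Function.comp]
    linear_combination (-1 / 2) * e2
  have hreal := real_poly hg hmono p hdeg hgap htot htot'
  rw [hreal] at hder' hb1' hb2'
  obtain ⟨b, α, β, hb, hp⟩ := factor hg hmono p hdeg hgap hreal
  have hgap0 : (∫ x in a 1..a 2, W a (2 * g + 2) p x) = 1 / 2 := by
    have := hgap 0 (by omega)
    simpa using this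
  have hlimI : Tendsto (fun r : ℝ => ∫ x in (-r)..r, W a (2 * g + 2) p x) atTop (nhds 0) := by
    have h := hfar.const_mul (-1 / 2)
    rw [mul_zero] at h
    refine h.congr' ?_
    filter_upwards [eventually_gt_atTop (a (2 * g + 1)), eventually_gt_atTop (-a 0)] with r hr1 hr2
    rw [hb2 r (Or.inr hr1), hb2 (-r) (Or.inl (by linarith)),
      ← intervalIntegral.integral_add_adjacent_intervals (hI p (-r) (a 0)) (hI p (a 0) r),
      intervalIntegral.integral_symm (-r) (a 0)]
    ring
  have hL := L_pos hg hmono hb hp hgap0 htot hlimI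
  have h0i : ∀ i, i ≤ 2 * g + 1 → a 0 ≤ a i := fun i hi => by
    rcases Nat.eq_zero_or_pos i with h | h
    · rw [h]
    · exact (hmono _ _ h (by omega)).le
  have hil : ∀ i, i ≤ 2 * g + 1 → a i ≤ a (2 * g + 1) := fun i hi => by
    rcases hi.lt_or_eq with h | h
    · exact (hmono _ _ h (by omega)).le
    · rw [h]
  have hpne : ∀ i, i ≤ 2 * g + 1 → p.eval (a i : ℂ) ≠ 0 := by
    intro i hi
    rw [hp]
    refine mul_ne_zero (Finset.prod_ne_zero_iff.2 fun k hk => ?_) ?_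
    · have hk := Finset.mem_range.1 hk
      rw [sub_ne_zero]
      have hbk := hb k hk
      intro h
      have h : a i = b k := by exact_mod_cast h
      exact arc_ne hmono (i := 2 * k + 3) (by omega) hbk i (by omega) h.symm
    · have := hL (a i) ⟨h0i i hi, hil i hi⟩
      exact_mod_cast this.ne'
  have hpim : ∀ x : ℝ, (p.eval (x : ℂ)).im = 0 := fun x => by
    rw [← Complex.conj_eq_iff_im, ← eval_conj, hreal]
  set σ : ℝ := if t = 0 ∨ t = g then 1 else -1 with hσd
  have hσ : σ = 1 ∨ σ = -1 := by rw [hσd]; split_ifs <;> simp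
  have harc : ∀ x ∈ Ioo (a (2 * t)) (a (2 * t + 1)), σ * (W a (2 * g + 2) p x).im < 0 ∧
      (W a (2 * g + 2) p x).re = 0 := by
    intro x hx
    obtain ⟨c, hc, e⟩ := W_arc hg hmono hb hp ht hx
    have hLx := hL x ⟨(h0i (2 * t) (by omega)).trans hx.1.le, hx.2.le.trans (hil (2 * t + 1) (by omega))⟩
    have := mul_pos hc hLx
    rw [e, I_mul_im, I_mul_re, ofReal_re, ofReal_im, hσd]
    refine ⟨?_, neg_zero⟩
    split_ifs <;> linarith
  have hval : ∀ x ∈ Icc (a (2 * t)) (a (2 * t + 1)),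
      σ * (1 / 2 - 2 * ∫ y in a 0..x, W a (2 * g + 2) p y).re = 1 / 2 := by
    intro x hx
    have hv := values hg hmono hb hp hgap htot ht hx
    have : (1 / 2 - 2 * ∫ y in a 0..x, W a (2 * g + 2) p y).re
        = 1 / 2 - 2 * (∫ y in a 0..x, W a (2 * g + 2) p y).re := by simp
    rw [this, hv, hσd]
    split_ifs <;> norm_num
  obtain ⟨δ, hδ, u1, u2⟩ := local_up hmono p hpim (i := 2 * t) (by omega) (hpne _ (by omega)) (hpne _ (by omega))
    hσ harc F hder hb1 hval hx₀
  obtain ⟨δ', hδ', u1', -⟩ := local_up hmono p hpim (i := 2 * t) (by omega) (hpne _ (by omega)) (hpne _ (by omega))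
    hσ harc _ hder' hb1' hval hx₀
  filter_upwards [Metric.ball_mem_nhds _ hδ, Metric.ball_mem_nhds _ hδ'] with z hz hz' hzc
  rcases lt_trichotomy z.im 0 with h | h | h
  · have := u1' ((starRingEnd ℂ) z) (by
      rw [Metric.mem_ball] at hz' ⊢
      rw [← Complex.conj_ofReal x₀, Complex.dist_conj_conj]; exact hz') (by simpa using h)
    simpa using this
  · obtain ⟨x, rfl⟩ : ∃ x : ℝ, z = x := ⟨z.re, Complex.ext (by simp) (by simp [h])⟩
    have hx : x < a 0 ∨ a (2 * g + 1) < x := by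
      by_contra hcon
      push Not at hcon
      exact hzc ⟨x, ⟨hcon.1, hcon.2⟩, rfl⟩
    rw [hb2 x hx]
    refine u2 x ?_ ?_
    · rw [Metric.mem_ball, dist_eq_norm, ← ofReal_sub, Complex.norm_real, Real.norm_eq_abs] at hz
      exact hz
    · rintro ⟨h1, h2⟩
      have := h0i (2 * t) (by omega)
      have := hil (2 * t + 1) (by omega)
      rcases hx with hx | hx <;> linarith
  · exact u1 z hz h

end GSigns

/-- Real-part sign conditions for the `g`-function: there are open neighborhoods
`U ⊇ I_i` and `V ⊇ I_e` (with `U` disjoint from `I_e` and `V` disjoint from `I_i`)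
such that `Re(2𝔤(z) + 1) > 0` on `U` minus the cut and `Re(2𝔤(z) - 1) < 0` on `V`
minus the cut. -/
theorem g_function_real_part_signs
    (g : ℕ) (hg : 2 ≤ g)
    (a : ℕ → ℝ) (ha : ∀ i, i < 2 * g + 1 → a i < a (i + 1))
    (arcs : Set ℂ)
    (harcs : arcs = ⋃ t ∈ Finset.range (g + 1),
      Complex.ofReal '' Icc (a (2 * t)) (a (2 * t + 1)))
    (Ie Ii : Set ℝ)
    (hIe : Ie = Icc (a 0) (a 1) ∪ Icc (a (2 * g)) (a (2 * g + 1)))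
    (hIi : Ii = ⋃ k ∈ Finset.Icc 1 (g - 1), Icc (a (2 * k)) (a (2 * k + 1)))
    (R : ℂ → ℂ)
    (hRan : DifferentiableOn ℂ R arcsᶜ)
    (hRsq : ∀ z ∉ arcs, R z ^ 2 = ∏ j ∈ Finset.range (2 * g + 2), (z - (a j : ℂ)))
    (hRinf : Tendsto (fun z : ℂ => R z / z ^ (g + 1)) (cocompact ℂ) (nhds 1))
    (P : Polynomial ℂ) (hPdeg : P.natDegree ≤ g - 1)
    (ω : ℂ → ℂ)
    (hω : ∀ z ∉ arcs, ω z = Polynomial.eval z P / R z)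
    (ωp : ℝ → ℂ)
    (hωp : ∀ x : ℝ, (∀ i ≤ 2 * g + 1, x ≠ a i) →
        Tendsto ω (nhdsWithin (x : ℂ) {z : ℂ | 0 < z.im}) (nhds (ωp x)))
    (hnorm : ∀ k : ℕ, k ≤ g - 1 →
        (if k + 1 ≤ g - 1 then
            2 * ∫ x in (a (2 * k + 1))..(a (2 * k + 2)), ωp x
          else
            2 * ∫ x in (a 0)..(a (2 * g + 1)), ωp x)
          = if k = 0 then 1 else 0)
    (𝔤 : ℂ → ℂ)
    (cut : Set ℂ) (hcut : cut = Complex.ofReal '' Icc (a 0) (a (2 * g + 1)))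
    (h𝔤an : DifferentiableOn ℂ 𝔤 cutᶜ)
    (h𝔤deriv : ∀ z ∉ cut, HasDerivAt 𝔤 (-2 * ω z) z)
    (h𝔤a1 : Tendsto (fun t : ℝ => 𝔤 ((a 0 - t : ℝ) : ℂ)) (nhdsWithin 0 (Ioi 0))
      (nhds (1 / 2))) :
    ∃ U V : Set ℂ, IsOpen U ∧ IsOpen V ∧
      Complex.ofReal '' Ii ⊆ U ∧ Complex.ofReal '' Ie ⊆ V ∧
      Disjoint U (Complex.ofReal '' Ie) ∧ Disjoint V (Complex.ofReal '' Ii) ∧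
      (∀ z ∈ U, z ∉ cut → 0 < (2 * 𝔤 z + 1).re) ∧
      (∀ z ∈ V, z ∉ cut → (2 * 𝔤 z - 1).re < 0) := by
  have hmono : ∀ i j, i < j → j < 2 * g + 2 → a i < a j := by
    intro i j hij
    induction j with
    | zero => omega
    | succ j ih =>
      intro hj
      rcases (Nat.lt_succ_iff.1 hij).lt_or_eq with h | h
      · exact (ih h (by omega)).trans (ha j (by omega))
      · rw [h]; exact ha j (by omega)
  have hmonole : ∀ i j, i ≤ j → j < 2 * g + 2 → a i ≤ a j := by
    intro i j hij hj
    rcases hij.lt_or_eq with h | h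
    · exact (hmono _ _ h hj).le
    · rw [h]
  have harcsub : arcs ⊆ cut := by
    rw [harcs, hcut]
    intro z hz
    simp only [mem_iUnion, Finset.mem_range] at hz
    obtain ⟨t, ht, x, hx, rfl⟩ := hz
    exact ⟨x, ⟨(hmonole 0 (2 * t) (by omega) (by omega)).trans hx.1,
      hx.2.trans (hmonole (2 * t + 1) (2 * g + 1) (by omega) (by omega))⟩, rfl⟩
  have hcutr : ∀ z ∈ cut, z.im = 0 ∧ z.re ∈ Icc (a 0) (a (2 * g + 1)) := by
    rw [hcut]
    rintro z ⟨x, hx, rfl⟩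
    exact ⟨ofReal_im x, hx⟩
  have hcutim : ∀ z : ℂ, z.im ≠ 0 → z ∉ cut := fun z hz h => hz (hcutr z h).1
  have hclosed : IsClosed arcs := by
    rw [harcs]
    exact (Finset.isCompact_biUnion _ fun t _ => isCompact_Icc.image continuous_ofReal).isClosed
  obtain ⟨ε, hε, hR1, hR2⟩ := GSigns.R_eq (a := a) (n := 2 * g + 2) hclosed (fun z hz => (hcutr z (harcsub hz)).1)
    hRan hRsq (x₀ := a (2 * g + 1) + 1)
    (fun j hj => by linarith [hmonole j (2 * g + 1) (by omega) (by omega)])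
    (fun h => by have := (hcutr _ (harcsub h)).2.2; rw [ofReal_re] at this; linarith)
  have hεε : ε * ε = 1 := by rcases hε with rfl | rfl <;> norm_num
  have hε0 : ε ≠ 0 := by rcases hε with rfl | rfl <;> norm_num
  have hεc : (starRingEnd ℂ) ε = ε := by rcases hε with rfl | rfl <;> simp
  obtain ⟨p, hpd⟩ : ∃ p : Polynomial ℂ, p = Polynomial.C ε * P := ⟨_, rfl⟩
  have hpdeg : p.natDegree ≤ g - 1 := by
    rw [hpd]; exact (Polynomial.natDegree_C_mul_le _ _).trans hPdeg
  have hpev : ∀ z, p.eval z = ε * P.eval z := fun z => by rw [hpd]; simp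
  have hωW : ∀ z : ℂ, 0 < z.im → ω z = GSigns.W a (2 * g + 2) p z := by
    intro z hz
    rw [hω z (fun h => hcutim z hz.ne' (harcsub h)), hR1 z hz, GSigns.W, hpev]
    have := GSigns.S_ne a (2 * g + 2) z
    field_simp
    linear_combination (-(P.eval z)) * hεε
  have hωW' : ∀ z : ℂ, 0 < z.im → (starRingEnd ℂ) (ω ((starRingEnd ℂ) z))
      = GSigns.W a (2 * g + 2) (p.map (starRingEnd ℂ)) z := by
    intro z hz
    have hz' : ((starRingEnd ℂ) z).im ≠ 0 := by simpa using hz.ne'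
    rw [hω _ (fun h => hcutim _ hz' (harcsub h)), map_div₀, hR2 z hz, GSigns.W]
    have e : (p.map (starRingEnd ℂ)).eval z = ε * (starRingEnd ℂ) (P.eval ((starRingEnd ℂ) z)) := by
      have h := Polynomial.eval_map_apply (p := p) (f := starRingEnd ℂ) ((starRingEnd ℂ) z)
      rw [Complex.conj_conj] at h
      rw [h, hpev, map_mul, hεc]
    rw [e]
    have := GSigns.S_ne a (2 * g + 2) z
    field_simp
    linear_combination (-((starRingEnd ℂ) (P.eval ((starRingEnd ℂ) z)))) * hεε
  have hωpW : ∀ x : ℝ, (∀ j < 2 * g + 2, x ≠ a j) → ωp x = GSigns.W a (2 * g + 2) p x := by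
    intro x hx
    have h1 := hωp x (fun i hi => hx i (by omega))
    have h2 : Tendsto (GSigns.W a (2 * g + 2) p) (nhdsWithin (x : ℂ) {z : ℂ | 0 < z.im})
        (nhds (GSigns.W a (2 * g + 2) p x)) :=
      (GSigns.W_diff p (fun j hj => by exact_mod_cast hx j hj) (by simp)).continuousAt.tendsto.mono_left
        nhdsWithin_le_nhds
    have : (nhdsWithin (x : ℂ) {z : ℂ | 0 < z.im}).NeBot := by
      rw [← mem_closure_iff_nhdsWithin_neBot, Complex.closure_setOf_lt_im]
      simp
    refine tendsto_nhds_unique h1 (h2.congr' ?_)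
    filter_upwards [self_mem_nhdsWithin] with z hz using (hωW z hz).symm
  have hinteg : ∀ u v : ℝ, (∫ x in u..v, ωp x) = ∫ x in u..v, GSigns.W a (2 * g + 2) p x := by
    intro u v
    refine intervalIntegral.integral_congr_ae ?_
    filter_upwards [GSigns.ae_ne a (2 * g + 2)] with x hx _ using hωpW x hx
  have hgap : ∀ k, k + 1 ≤ g - 1 →
      (∫ x in a (2 * k + 1)..a (2 * k + 2), GSigns.W a (2 * g + 2) p x) = if k = 0 then 1 / 2 else 0 := by
    intro k hk
    have h := hnorm k (by omega)
    rw [if_pos hk, hinteg] at h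
    split_ifs at h ⊢
    · linear_combination h / 2
    · linear_combination h / 2
  have htot : (∫ x in a 0..a (2 * g + 1), GSigns.W a (2 * g + 2) p x) = 0 := by
    have h := hnorm (g - 1) le_rfl
    rw [if_neg (by omega), if_neg (by omega), hinteg] at h
    linear_combination h / 2
  have hfar : Tendsto (fun r : ℝ => 𝔤 (r : ℂ) - 𝔤 ((-r : ℝ) : ℂ)) atTop (nhds 0) := by
    obtain ⟨C, r₀, hC, hr₀, har, hbd⟩ := GSigns.omega_bound a hg P hPdeg
    have hnc : ∀ z : ℂ, r₀ ≤ ‖z‖ → z ∉ cut := by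
      intro z hz hzc
      rw [hcut] at hzc
      obtain ⟨x, hx, rfl⟩ := hzc
      rw [Complex.norm_real, Real.norm_eq_abs] at hz
      have h1 := abs_lt.1 (har 0 (by omega))
      have h2 := abs_lt.1 (har (2 * g + 1) (by omega))
      have h3 : |x| < r₀ := abs_lt.2 ⟨by linarith [hx.1], by linarith [hx.2]⟩
      linarith
    refine GSigns.far hC hr₀ (fun z hz => h𝔤deriv z (hnc z hz)) (fun z hz => ?_)
    have hza : z ∉ arcs := fun h => hnc z hz (harcsub h)
    rw [hω z hza]
    exact hbd z (R z) hz (hRsq z hza)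
  have hcore := fun (t : ℕ) (ht : t ≤ g) (x₀ : ℝ) (hx₀ : x₀ ∈ Icc (a (2 * t)) (a (2 * t + 1))) =>
    GSigns.core hg hmono p hpdeg 𝔤
      (fun z hz => by rw [← hωW z hz]; exact h𝔤deriv z (hcutim z hz.ne'))
      (fun z hz => by
        have hz' : ((starRingEnd ℂ) z).im ≠ 0 := by simpa using hz.ne'
        have h := (h𝔤deriv _ (hcutim _ hz')).conj_conj
        rw [Complex.conj_conj, map_mul, hωW' z hz, map_neg, map_ofNat] at h
        exact h)
      (fun x hx => (h𝔤deriv x (fun h => by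
        have := (hcutr _ h).2
        rw [ofReal_re] at this
        rcases hx with hx | hx
        · linarith [this.1]
        · linarith [this.2])).continuousAt)
      h𝔤a1 hgap htot hfar ht hx₀
  rw [← hcut] at hcore
  refine ⟨interior {z | z ∉ cut → 0 < (2 * 𝔤 z + 1).re} ∩ {z | a 1 < z.re ∧ z.re < a (2 * g)},
    interior {z | z ∉ cut → (2 * 𝔤 z - 1).re < 0} ∩ {z | z.re < a 2 ∨ a (2 * g - 1) < z.re},
    isOpen_interior.inter ?_, isOpen_interior.inter ?_, ?_, ?_, ?_, ?_, ?_, ?_⟩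
  · exact (isOpen_lt continuous_const continuous_re).inter (isOpen_lt continuous_re continuous_const)
  · exact (isOpen_lt continuous_re continuous_const).union (isOpen_lt continuous_const continuous_re)
  · rintro _ ⟨x, hx, rfl⟩
    rw [hIi] at hx
    simp only [mem_iUnion, Finset.mem_Icc] at hx
    obtain ⟨k, hk, hx⟩ := hx
    refine ⟨?_, ?_, ?_⟩
    · rw [mem_interior_iff_mem_nhds]
      filter_upwards [hcore k (by omega) x hx] with z hz hzc
      have h := hz hzc
      rw [if_neg (by omega)] at h
      simp
      linarith
    · rw [ofReal_re]; exact (hmono 1 (2 * k) (by omega) (by omega)).trans_le hx.1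
    · rw [ofReal_re]; exact hx.2.trans_lt (hmono (2 * k + 1) (2 * g) (by omega) (by omega))
  · rintro _ ⟨x, hx, rfl⟩
    rw [hIe] at hx
    have hk : ∃ t, (t = 0 ∨ t = g) ∧ x ∈ Icc (a (2 * t)) (a (2 * t + 1)) := by
      rcases hx with hx | hx
      · exact ⟨0, Or.inl rfl, hx⟩
      · exact ⟨g, Or.inr rfl, hx⟩
    obtain ⟨t, ht, hxt⟩ := hk
    refine ⟨?_, ?_⟩
    · rw [mem_interior_iff_mem_nhds]
      filter_upwards [hcore t (by omega) x hxt] with z hz hzc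
      have h := hz hzc
      rw [if_pos ht] at h
      simp
      linarith
    · rw [mem_setOf_eq, ofReal_re]
      rcases hx with hx | hx
      · exact Or.inl (hx.2.trans_lt (hmono 1 2 (by omega) (by omega)))
      · exact Or.inr ((hmono (2 * g - 1) (2 * g) (by omega) (by omega)).trans_le hx.1)
  · rw [Set.disjoint_left]
    rintro z ⟨-, h1, h2⟩ ⟨x, hx, rfl⟩
    rw [ofReal_re] at h1 h2
    rw [hIe] at hx
    rcases hx with hx | hx
    · linarith [hx.2]
    · linarith [hx.1]
  · rw [Set.disjoint_left]
    rintro z ⟨-, h1⟩ ⟨x, hx, rfl⟩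
    rw [mem_setOf_eq, ofReal_re] at h1
    rw [hIi] at hx
    simp only [mem_iUnion, Finset.mem_Icc] at hx
    obtain ⟨k, hk, hx⟩ := hx
    have h2 := hmonole 2 (2 * k) (by omega) (by omega)
    have h3 := hmonole (2 * k + 1) (2 * g - 1) (by omega) (by omega)
    rcases h1 with h1 | h1
    · linarith [hx.1]
    · linarith [hx.2]
  · rintro z ⟨hz, -⟩ hzc
    exact interior_subset hz hzc
  · rintro z ⟨hz, -⟩ hzc
    exact interior_subset hz hzc
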